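/- arXiv:0801.3624 — 2 statements merged into one kernel-verified Lean document; each statement's English description precedes it below -/
import Mathlib

section
/- (Orthogonality–Discrepancy Lemma, main inequality.) Let k ≥ 2, ℓ ≥ 2, m ≥ 1, d ≥ 1 be integers, let μ be a probability distribution on {0,1}^m, and let f : {0,1}^m → {−1,1} be (μ,d)-orthogonal. Let n = ℓ^{k−1}m and let λ be the probability distribution on {0,1}^n × ([ℓ]^m)^{k−1} given by λ(x, S^1,…,S^{k−1}) = μ(x ← S^1,…,S^{k−1})/(ℓ^{m(k−1)} 2^{n−m}). Then (disc_{k,λ}(F^f_k))^{2^{k−1}} ≤ Σ_{j=d}^{(k−1)m} C((k−1)m, j) · (2^{2^{k−1}−1}/(ℓ−1))^j, where C(·,·) denotes the binomial coefficient. -/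
open scoped BigOperators

/-- `x ← S^1,…,S^{K}`: with `x ∈ {0,1}^n` (`n = ℓ^K·m`) viewed as `m` blocks, each a
`K`-dimensional array of side `ℓ`, the `α`-th bit of the result is
`x[α][S^1[α],…,S^K[α]]`. -/
def mask {K ℓ m : ℕ} (x : Fin m → (Fin K → Fin ℓ) → Bool)
    (S : Fin K → Fin m → Fin ℓ) : Fin m → Bool :=
  fun α => x α (fun i => S i α)

/-- The masked function `F^f_k (x, S^1,…,S^{k-1}) = f(x ← S^1,…,S^{k-1})`. -/
def Ffun {K ℓ m : ℕ} (f : (Fin m → Bool) → ℝ)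
    (p : (Fin m → (Fin K → Fin ℓ) → Bool) × (Fin K → Fin m → Fin ℓ)) : ℝ :=
  f (mask p.1 p.2)

/-- A probability distribution on a finite set. -/
def IsProbDist {D : Type*} [Fintype D] (μ : D → ℝ) : Prop :=
  (∀ x, 0 ≤ μ x) ∧ ∑ x, μ x = 1

/-- The distribution `λ(x,S^1,…,S^{k-1}) = μ(x ← S^1,…,S^{k-1}) / (ℓ^{m(k-1)} 2^{n-m})`. -/
noncomputable def lamDist (k ℓ m n : ℕ) (μ : (Fin m → Bool) → ℝ)
    (p : (Fin m → (Fin (k - 1) → Fin ℓ) → Bool) × (Fin (k - 1) → Fin m → Fin ℓ)) : ℝ :=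
  μ (mask p.1 p.2) / ((ℓ : ℝ) ^ (m * (k - 1)) * 2 ^ (n - m))

/-- A cylinder intersection on the `k`-party domain `{0,1}^n × ([ℓ]^m)^{k-1}`
(one player holds `x`, and one player holds each `S^i`): a conjunction of a cylinder
not depending on `x` and, for each `i`, a cylinder not depending on `S^i`. -/
def IsCylinderIntersection {X V : Type*} {K : ℕ}
    (φ : X × (Fin K → V) → Bool) : Prop :=
  ∃ (ψ₀ : X × (Fin K → V) → Bool) (ψ : Fin K → X × (Fin K → V) → Bool),
    (∀ x x' S, ψ₀ (x, S) = ψ₀ (x', S)) ∧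
    (∀ i x S S', (∀ j, j ≠ i → S j = S' j) → ψ i (x, S) = ψ i (x, S')) ∧
    (∀ p, φ p = (ψ₀ p && decide (∀ i, ψ i p = true)))

/-- Interpret a boolean as the real `0` or `1`. -/
noncomputable def bval (b : Bool) : ℝ := if b then 1 else 0

/-- `disc^φ_{k,λ}(F) = |E_{y∼λ}[F(y)φ(y)]|`. -/
noncomputable def discPhi {D : Type*} [Fintype D] (lam : D → ℝ) (F : D → ℝ)
    (φ : D → Bool) : ℝ :=
  |∑ y, lam y * F y * bval (φ y)|

/-- `disc_{k,λ}(F)`: the supremum of `disc^φ_{k,λ}(F)` over cylinder intersections `φ`. -/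
noncomputable def disc {X V : Type*} [Fintype X] [Fintype V] {K : ℕ}
    (lam : X × (Fin K → V) → ℝ) (F : X × (Fin K → V) → ℝ) : ℝ :=
  sSup { t | ∃ φ, IsCylinderIntersection φ ∧ t = discPhi lam F φ }

/-- The character `χ_S(x) = (-1)^{Σ_{i∈S} x_i}`. -/
noncomputable def chiChar {m : ℕ} (S : Finset (Fin m)) (z : Fin m → Bool) : ℝ :=
  ∏ i ∈ S, (if z i then (-1 : ℝ) else 1)

/-- `f` is `(μ,d)`-orthogonal: `E_{x∼μ}[f(x)χ_S(x)] = 0` for every `S` with `|S| < d`. -/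
def Orthogonal {m : ℕ} (μ : (Fin m → Bool) → ℝ) (d : ℕ) (f : (Fin m → Bool) → ℝ) : Prop :=
  ∀ S : Finset (Fin m), S.card < d → ∑ z, μ z * f z * chiChar S z = 0

lemma exp_prod {A B : Type*} [Fintype A] [Fintype B] (f : A × B → ℝ) :
    𝔼 p, f p = 𝔼 a, 𝔼 b, f (a, b) := by
  rw [← Finset.univ_product_univ, Finset.expect_product]

lemma exp_comm {A B : Type*} [Fintype A] [Fintype B] (f : A → B → ℝ) :
    𝔼 a, 𝔼 b, f a b = 𝔼 b, 𝔼 a, f a b := Finset.expect_comm _ _ _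

lemma exp_cons {V : Type*} [Fintype V] {K : ℕ} (f : (Fin (K + 1) → V) → ℝ) :
    𝔼 S, f S = 𝔼 v, 𝔼 S, f (Fin.cons v S : Fin (K + 1) → V) := by
  rw [← exp_prod (fun p : V × (Fin K → V) => f (Fin.cons p.1 p.2))]
  symm
  exact Fintype.expect_equiv (Fin.consEquiv (fun _ => V)) _ _ (fun _ => rfl)

lemma exp_pi {ι : Type*} {κ : Type*} [Fintype ι] [DecidableEq ι] [Fintype κ]
    (f : ι → κ → ℝ) :
    𝔼 x : ι → κ, ∏ i, f i (x i) = ∏ i, 𝔼 j, f i j := by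
  simp only [Fintype.expect_eq_sum_div_card]
  rw [Finset.prod_div_distrib, Fintype.prod_sum]
  simp

/-- choose between two tuples coordinatewise -/
def sel {K : ℕ} {V : Type*} (u : Fin K → Bool) (S T : Fin K → V) : Fin K → V :=
  fun i => if u i then T i else S i

lemma sel_cons {K : ℕ} {V : Type*} (b : Bool) (u : Fin K → Bool) (v w : V) (S T : Fin K → V) :
    sel (Fin.cons b u : Fin (K + 1) → Bool) (Fin.cons v S : Fin (K + 1) → V) (Fin.cons w T : Fin (K + 1) → V)
      = (Fin.cons (if b then w else v) (sel u S T) : Fin (K + 1) → V) := by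
  funext i
  refine Fin.cases ?_ (fun i => ?_) i <;> simp [sel]

lemma prod_cons_bool {K : ℕ} (f : (Fin (K + 1) → Bool) → ℝ) :
    ∏ u, f u = ∏ u : Fin K → Bool, f (Fin.cons false u : Fin (K + 1) → Bool) * f (Fin.cons true u : Fin (K + 1) → Bool) := by
  rw [← (Fin.consEquiv (fun _ => Bool)).prod_comp, Fintype.prod_prod_type, Fintype.prod_bool,
    ← Finset.prod_mul_distrib]
  refine Finset.prod_congr rfl fun u _ => ?_
  rw [mul_comm]; rfl

lemma cs_exp {A : Type*} [Fintype A] (f g : A → ℝ) (hf : ∀ a, |f a| ≤ 1) :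
    (𝔼 a, f a * g a) ^ 2 ≤ 𝔼 a, g a ^ 2 := by
  refine (Finset.expect_mul_sq_le_sq_mul_sq _ _ _).trans ?_
  have h0 : 0 ≤ 𝔼 a, g a ^ 2 := Finset.expect_nonneg fun _ _ => sq_nonneg _
  have h1 : 𝔼 a, f a ^ 2 ≤ 1 := by
    cases isEmpty_or_nonempty A
    · simp
    · exact Finset.expect_le Finset.univ_nonempty fun a _ => by
        rw [sq_le_one_iff_abs_le_one]; exact hf a
  nlinarith

lemma bns {V : Type} [Fintype V] (K : ℕ) : ∀ (X : Type) [Fintype X]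
    (G : X → (Fin K → V) → ℝ) (ψ : Fin K → X → (Fin K → V) → ℝ)
    (_ : ∀ i x S, |ψ i x S| ≤ 1)
    (_ : ∀ i x S S', (∀ j, j ≠ i → S j = S' j) → ψ i x S = ψ i x S'),
    (𝔼 x, 𝔼 S, G x S * ∏ i, ψ i x S) ^ (2 ^ K) ≤
      𝔼 x, 𝔼 S, 𝔼 T, ∏ u, G x (sel u S T) := by
  induction K with
  | zero =>
    intro X _ G ψ _ _
    refine le_of_eq ?_
    simp only [pow_zero, pow_one, Finset.univ_eq_empty, Finset.prod_empty, mul_one]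
    refine Finset.expect_congr rfl fun x _ => ?_
    refine Finset.expect_congr rfl fun S _ => ?_
    rw [Finset.expect_congr rfl (g := fun _ => G x S), Fintype.expect_const]
    intro T _
    rw [Fintype.prod_unique]
    congr 1
    exact Subsingleton.elim _ _
  | succ K ih =>
    intro X _ G ψ h1 h2
    cases isEmpty_or_nonempty V
    · have : IsEmpty (Fin (K + 1) → V) := ⟨fun h => IsEmpty.false (h 0)⟩
      simp
    obtain ⟨v0⟩ := ‹Nonempty V›
    let A : X × (Fin K → V) → V → ℝ := fun p v =>
      G p.1 (Fin.cons v p.2 : Fin (K + 1) → V) * ∏ i : Fin K, ψ i.succ p.1 (Fin.cons v p.2 : Fin (K + 1) → V)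
    have e1 : 𝔼 x, 𝔼 S, G x S * ∏ i, ψ i x S =
        𝔼 p : X × (Fin K → V), ψ 0 p.1 (Fin.cons v0 p.2 : Fin (K + 1) → V) * 𝔼 v, A p v := by
      rw [exp_prod]
      refine Finset.expect_congr rfl fun x _ => ?_
      rw [exp_cons, exp_comm]
      refine Finset.expect_congr rfl fun S _ => ?_
      rw [Finset.mul_expect]
      refine Finset.expect_congr rfl fun v _ => ?_
      rw [Fin.prod_univ_succ, h2 0 x (Fin.cons v S : Fin (K + 1) → V) (Fin.cons v0 S : Fin (K + 1) → V)]
      · simp only [A]; ring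
      · intro j hj
        obtain ⟨j, rfl⟩ := Fin.exists_succ_eq.mpr hj
        simp
    have e2 := cs_exp (fun p : X × (Fin K → V) => ψ 0 p.1 (Fin.cons v0 p.2 : Fin (K + 1) → V))
      (fun p => 𝔼 v, A p v) (fun p => h1 _ _ _)
    rw [← e1] at e2
    have e3 : 𝔼 p, (𝔼 v, A p v) ^ 2 = 𝔼 y : X × V × V, 𝔼 S : Fin K → V,
        (G y.1 (Fin.cons y.2.1 S : Fin (K + 1) → V) * G y.1 (Fin.cons y.2.2 S : Fin (K + 1) → V)) *
        ∏ i : Fin K, (ψ i.succ y.1 (Fin.cons y.2.1 S : Fin (K + 1) → V) * ψ i.succ y.1 (Fin.cons y.2.2 S : Fin (K + 1) → V)) := by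
      rw [exp_prod, exp_prod]
      refine Finset.expect_congr rfl fun x _ => ?_
      rw [exp_comm]
      refine Finset.expect_congr rfl fun S _ => ?_
      rw [exp_prod, sq, Fintype.expect_mul_expect]
      refine Finset.expect_congr rfl fun v _ => ?_
      refine Finset.expect_congr rfl fun w _ => ?_
      simp only [A]
      rw [Finset.prod_mul_distrib]
      ring
    rw [e3] at e2
    rw [pow_succ', pow_mul]
    refine (pow_le_pow_left₀ (sq_nonneg _) e2 _).trans ?_
    refine (ih (X × V × V)
      (fun y S => G y.1 (Fin.cons y.2.1 S : Fin (K + 1) → V) * G y.1 (Fin.cons y.2.2 S : Fin (K + 1) → V))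
      (fun i y S => ψ i.succ y.1 (Fin.cons y.2.1 S : Fin (K + 1) → V) * ψ i.succ y.1 (Fin.cons y.2.2 S : Fin (K + 1) → V))
      ?_ ?_).trans ?_
    · intro i y S
      rw [abs_mul]
      exact mul_le_one₀ (h1 _ _ _) (abs_nonneg _) (h1 _ _ _)
    · intro i y S S' h
      have : ∀ v : V, ψ i.succ y.1 (Fin.cons v S : Fin (K + 1) → V) = ψ i.succ y.1 (Fin.cons v S' : Fin (K + 1) → V) := by
        intro v
        apply h2
        intro j
        refine Fin.cases ?_ (fun j => ?_) j
        · simp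
        · intro hj
          simpa using h j (fun e => hj (by rw [e]))
      simp only [this]
    · refine le_of_eq ?_
      rw [exp_prod]
      refine Finset.expect_congr rfl fun x _ => ?_
      rw [exp_prod, exp_cons]
      refine Finset.expect_congr rfl fun v _ => ?_
      rw [exp_comm]
      refine Finset.expect_congr rfl fun S _ => ?_
      rw [exp_cons]
      refine Finset.expect_congr rfl fun w _ => ?_
      refine Finset.expect_congr rfl fun T _ => ?_
      rw [prod_cons_bool]
      refine Finset.prod_congr rfl fun u _ => ?_
      simp [sel_cons]

lemma count_one {C U : Type} [Fintype C] [DecidableEq C] [DecidableEq U] (s : Finset U)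
    (q : U → C) (hq : Set.InjOn q s) (w : U → Bool) :
    𝔼 y : C → Bool, ∏ u ∈ s, (if y (q u) = w u then (1 : ℝ) else 0) = (1 / 2) ^ s.card := by
  let F : C → Bool → ℝ := fun (c : C) (b : Bool) =>
        ∏ u ∈ s.filter (fun u => q u = c), (if b = w u then (1 : ℝ) else 0)
  have h1 : ∀ y : C → Bool, ∏ u ∈ s, (if y (q u) = w u then (1 : ℝ) else 0) =
      ∏ c, F c (y c) := by
    intro y
    rw [← Finset.prod_fiberwise s q]
    refine Finset.prod_congr rfl fun c _ => Finset.prod_congr rfl fun u hu => ?_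
    rw [(Finset.mem_filter.mp hu).2]
  rw [Finset.expect_congr rfl (fun y _ => h1 y), exp_pi]
  have h2 : s.card = ∑ c : C, (s.filter (fun u => q u = c)).card :=
    Finset.card_eq_sum_card_fiberwise (fun _ _ => Finset.mem_coe.mpr (Finset.mem_univ _))
  rw [h2, ← Finset.prod_pow_eq_pow_sum]
  refine Finset.prod_congr rfl fun c _ => ?_
  simp only [F]
  rcases (s.filter (fun u => q u = c)).eq_empty_or_nonempty with h | ⟨u, hu⟩
  · rw [h]; simp
  · have : s.filter (fun u => q u = c) = {u} := by
      ext v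
      simp only [Finset.mem_filter, Finset.mem_singleton] at hu ⊢
      constructor
      · rintro ⟨hv, hc⟩
        exact hq hv hu.1 (hc.trans hu.2.symm)
      · rintro rfl; exact hu
    rw [this]
    simp [Fintype.expect_eq_sum_div_card]

lemma pbound {C U : Type} [Fintype C] [DecidableEq C] [DecidableEq U] [Fintype U] {m : ℕ}
    (μ : (Fin m → Bool) → ℝ) (hμ : IsProbDist μ) (q : U → Fin m → C) (B : Finset (Fin m))
    (u0 : U) (hq : ∀ α, α ∉ B → Function.Injective (fun u => q u α)) :
    𝔼 x : Fin m → C → Bool, ∏ u, (2 ^ m * μ (fun α => x α (q u α))) ≤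
      ((2 : ℝ) ^ (Fintype.card U - 1)) ^ B.card := by
  have h1 : ∀ y : Fin m → Bool, 2 ^ m * μ y =
      ∑ z, 2 ^ m * μ z * ∏ α, (if y α = z α then (1 : ℝ) else 0) := by
    intro y
    rw [Finset.sum_eq_single y]
    · simp
    · intro z _ hz
      have : ∃ α, y α ≠ z α := by
        by_contra! h
        exact hz (funext h).symm
      obtain ⟨α, hα⟩ := this
      rw [Finset.prod_eq_zero (Finset.mem_univ α) (by simp [hα]), mul_zero]
    · simp
  rw [Finset.expect_congr rfl (fun x _ => Finset.prod_congr rfl fun u _ => h1 _)]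
  simp_rw [Fintype.prod_sum]
  rw [Finset.expect_sum_comm]
  have h2 : ∀ z : U → Fin m → Bool,
      𝔼 x : Fin m → C → Bool, ∏ u, (2 ^ m * μ (z u) *
        ∏ α, (if x α (q u α) = z u α then (1 : ℝ) else 0)) ≤
      (∏ u, μ (z u)) * ((2 : ℝ) ^ (Fintype.card U - 1)) ^ B.card := by
    intro z
    let F : Fin m → (C → Bool) → ℝ := fun (α : Fin m) (y : C → Bool) =>
      ∏ u, (if y (q u α) = z u α then (1 : ℝ) else 0)
    have e : ∀ x : Fin m → C → Bool, ∏ u, (2 ^ m * μ (z u) *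
        ∏ α, (if x α (q u α) = z u α then (1 : ℝ) else 0)) =
        ((∏ u, μ (z u)) * (2 ^ m) ^ Fintype.card U) *
        ∏ α, F α (x α) := by
      intro x
      rw [Finset.prod_mul_distrib, Finset.prod_mul_distrib, Finset.prod_comm,
        Finset.prod_const, Finset.card_univ, mul_comm ((2 ^ m) ^ Fintype.card U)]
    rw [Finset.expect_congr rfl (fun x _ => e x), ← Finset.mul_expect, exp_pi, mul_assoc]
    refine mul_le_mul_of_nonneg_left ?_ (Finset.prod_nonneg fun u _ => hμ.1 _)
    have e2 : ((2 : ℝ) ^ m) ^ Fintype.card U = ∏ α : Fin m, 2 ^ Fintype.card U := by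
      simp [← pow_mul, mul_comm]
    have e3 : ((2 : ℝ) ^ (Fintype.card U - 1)) ^ B.card =
        ∏ α : Fin m, if α ∈ B then (2 : ℝ) ^ (Fintype.card U - 1) else 1 := by
      rw [Finset.prod_ite_mem]; simp
    rw [e2, e3, ← Finset.prod_mul_distrib]
    refine Finset.prod_le_prod (fun α _ => ?_) fun α _ => ?_
    · refine mul_nonneg (by positivity) (Finset.expect_nonneg fun y _ => Finset.prod_nonneg fun u _ => ?_)
      split_ifs <;> norm_num
    · split_ifs with hα
      · have h3 : 𝔼 y : C → Bool, ∏ u, (if y (q u α) = z u α then (1 : ℝ) else 0) ≤ 1 / 2 := by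
          have := count_one ({u0} : Finset U) (fun u => q u α) (by simp) (fun u => z u α)
          simp only [Finset.card_singleton, pow_one] at this
          rw [← this]
          refine Finset.expect_le_expect fun y _ => ?_
          rw [← Finset.mul_prod_erase _ _ (Finset.mem_univ u0), Finset.prod_singleton]
          refine mul_le_of_le_one_right (by split_ifs <;> norm_num) (Finset.prod_le_one ?_ ?_) <;>
          · intros; split_ifs <;> norm_num
        have h4 : (2 : ℝ) ^ Fintype.card U = 2 ^ (Fintype.card U - 1) * 2 := by
          rw [← pow_succ, Nat.sub_add_cancel (Fintype.card_pos_iff.mpr ⟨u0⟩)]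
        rw [h4, mul_assoc]
        refine mul_le_of_le_one_right (by positivity) (by linarith)
      · have := count_one (Finset.univ : Finset U) (fun u => q u α) ((hq α hα).injOn) (fun u => z u α)
        rw [this, Finset.card_univ, ← mul_pow]
        norm_num
  refine (Finset.sum_le_sum fun z _ => h2 z).trans ?_
  rw [← Finset.sum_mul, ← Fintype.prod_sum]
  simp [hμ.2]

lemma chi_inv {m : ℕ} (z y : Fin m → Bool) :
    ∑ T : Finset (Fin m), chiChar T z * chiChar T y = if z = y then (2 : ℝ) ^ m else 0 := by
  simp only [chiChar, ← Finset.prod_mul_distrib]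
  rw [← Finset.powerset_univ, ← Finset.prod_one_add]
  split_ifs with h
  · subst h
    have : ∀ i, (1 : ℝ) + (if z i then (-1 : ℝ) else 1) * (if z i then (-1 : ℝ) else 1) = 2 := by
      intro i; split_ifs <;> norm_num
    rw [Finset.prod_congr rfl (fun i _ => this i)]
    simp
  · have : ∃ i, z i ≠ y i := by
      by_contra! h'
      exact h (funext h')
    obtain ⟨i, hi⟩ := this
    refine Finset.prod_eq_zero (Finset.mem_univ i) ?_
    revert hi
    cases z i <;> cases y i <;> simp

lemma vanish {C U : Type} [Fintype C] [DecidableEq C] [DecidableEq U] [Fintype U] {m d : ℕ}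
    (g : (Fin m → Bool) → ℝ) (hg : ∀ T : Finset (Fin m), T.card < d → ∑ z, g z * chiChar T z = 0)
    (q : U → Fin m → C) (B : Finset (Fin m)) (hB : B.card < d)
    (u0 : U) (hq : ∀ α, α ∉ B → Function.Injective (fun u => q u α)) :
    ∑ x : Fin m → C → Bool, ∏ u, g (fun α => x α (q u α)) = 0 := by
  have h1 : ∀ y, g y = ∑ T : Finset (Fin m), (2 ^ m)⁻¹ * (∑ z, g z * chiChar T z) * chiChar T y := by
    intro y
    have : ∀ T : Finset (Fin m), (2 ^ m)⁻¹ * (∑ z, g z * chiChar T z) * chiChar T y =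
        ∑ z, (2 ^ m)⁻¹ * g z * (chiChar T z * chiChar T y) := by
      intro T
      rw [Finset.mul_sum, Finset.sum_mul]
      refine Finset.sum_congr rfl fun z _ => by ring
    simp_rw [this]
    rw [Finset.sum_comm]
    simp_rw [← Finset.mul_sum, chi_inv]
    simp
    field_simp
  have h2 : ∀ x : Fin m → C → Bool, ∏ u, g (fun α => x α (q u α)) =
      ∑ T : Finset (Fin m), (2 ^ m)⁻¹ * (∑ z, g z * chiChar T z) *
        (chiChar T (fun α => x α (q u0 α)) * ∏ u ∈ Finset.univ.erase u0, g (fun α => x α (q u α))) := by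
    intro x
    rw [← Finset.mul_prod_erase _ _ (Finset.mem_univ u0), h1 (fun α => x α (q u0 α)), Finset.sum_mul]
    refine Finset.sum_congr rfl fun T _ => by ring
  simp_rw [h2]
  rw [Finset.sum_comm]
  refine Finset.sum_eq_zero fun T _ => ?_
  rw [← Finset.mul_sum]
  by_cases hT : T.card < d
  · rw [hg T hT]; simp
  have : ∃ α ∈ T, α ∉ B := by
    by_contra! h
    exact hT ((Finset.card_le_card h).trans_lt hB)
  obtain ⟨α, hαT, hαB⟩ := this
  refine mul_eq_zero_of_right _ ?_
  let fl : (Fin m → C → Bool) → (Fin m → C → Bool) := fun x =>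
    Function.update x α (Function.update (x α) (q u0 α) (!(x α (q u0 α))))
  have hfl : Function.Involutive fl := by
    intro x
    simp [fl]
  have key : ∀ x : Fin m → C → Bool,
      chiChar T (fun β => fl x β (q u0 β)) * ∏ u ∈ Finset.univ.erase u0, g (fun β => fl x β (q u β))
      = -(chiChar T (fun β => x β (q u0 β)) * ∏ u ∈ Finset.univ.erase u0, g (fun β => x β (q u β))) := by
    intro x
    have k1 : chiChar T (fun β => fl x β (q u0 β)) = -chiChar T (fun β => x β (q u0 β)) := by
      unfold chiChar
      rw [← Finset.mul_prod_erase _ _ hαT, ← Finset.mul_prod_erase T (fun i => if x i (q u0 i) then (-1 : ℝ) else 1) hαT,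
        ← neg_mul]
      congr 1
      · simp only [fl, Function.update_self]
        cases x α (q u0 α) <;> simp
      · refine Finset.prod_congr rfl fun β hβ => ?_
        simp [fl, Function.update_of_ne (Finset.ne_of_mem_erase hβ)]
    have k2 : ∀ u ∈ Finset.univ.erase u0, g (fun β => fl x β (q u β)) = g (fun β => x β (q u β)) := by
      intro u hu
      congr 1
      funext β
      by_cases hβ : β = α
      · subst hβ
        have : q u β ≠ q u0 β := fun h => (Finset.ne_of_mem_erase hu) (hq β hαB h)
        simp [fl, Function.update_of_ne this]
      · simp [fl, Function.update_of_ne hβ]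
    rw [k1, Finset.prod_congr rfl k2, neg_mul]
  have h3 := Equiv.sum_comp (hfl.toPerm fl) (fun x : Fin m → C → Bool =>
    chiChar T (fun β => x β (q u0 β)) * ∏ u ∈ Finset.univ.erase u0, g (fun β => x β (q u β)))
  simp only [Function.Involutive.coe_toPerm, key, Finset.sum_neg_distrib] at h3
  linarith

lemma inner_bound {K ℓ m d : ℕ} (μ : (Fin m → Bool) → ℝ) (hμ : IsProbDist μ)
    (f : (Fin m → Bool) → ℝ) (hf : ∀ z, f z = 1 ∨ f z = -1) (horth : Orthogonal μ d f)
    (S T : Fin K → Fin m → Fin ℓ) :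
    |𝔼 x : Fin m → (Fin K → Fin ℓ) → Bool, ∏ u : Fin K → Bool,
      (2 ^ m * (μ (mask x (sel u S T)) * f (mask x (sel u S T))))| ≤
    ∑ A : Finset (Fin K × Fin m), if d ≤ A.card then
      ((2 : ℝ) ^ (2 ^ K - 1)) ^ A.card *
        ∏ p ∈ A, (if S p.1 p.2 = T p.1 p.2 then (1 : ℝ) else 0) else 0 := by
  let E : Finset (Fin K × Fin m) := Finset.univ.filter (fun p => S p.1 p.2 = T p.1 p.2)
  let B : Finset (Fin m) := E.image Prod.snd
  have hBE : B.card ≤ E.card := Finset.card_image_le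
  let q : (Fin K → Bool) → Fin m → (Fin K → Fin ℓ) := fun u α i => sel u S T i α
  have hq : ∀ α, α ∉ B → Function.Injective (fun u => q u α) := by
    intro α hα u v huv
    funext i
    have h1 : S i α ≠ T i α := by
      intro h
      exact hα (Finset.mem_image.mpr ⟨(i, α), by simp [E, h], rfl⟩)
    have h2 : sel u S T i α = sel v S T i α := congrFun huv i
    unfold sel at h2
    revert h2
    cases u i <;> cases v i <;> simp [h1, h1.symm]
  have hterm : ∀ A : Finset (Fin K × Fin m), 0 ≤ (if d ≤ A.card then
      ((2 : ℝ) ^ (2 ^ K - 1)) ^ A.card *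
        ∏ p ∈ A, (if S p.1 p.2 = T p.1 p.2 then (1 : ℝ) else 0) else 0) := by
    intro A
    split_ifs
    · refine mul_nonneg (by positivity) (Finset.prod_nonneg fun p _ => ?_)
      split_ifs <;> norm_num
    · exact le_rfl
  by_cases hd : d ≤ E.card
  · refine le_trans ?_ (Finset.single_le_sum (fun A _ => hterm A) (Finset.mem_univ E))
    rw [if_pos hd, Finset.prod_eq_one (fun p hp => if_pos (Finset.mem_filter.mp hp).2), mul_one]
    refine (Finset.abs_expect_le _ _).trans ?_
    have h1 := pbound μ hμ q B (fun _ => false) hq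
    have h2 : Fintype.card (Fin K → Bool) = 2 ^ K := by simp
    rw [h2] at h1
    refine le_trans ?_ (h1.trans (pow_le_pow_right₀ (one_le_pow₀ (by norm_num)) hBE))
    refine Finset.expect_le_expect fun x _ => ?_
    rw [Finset.abs_prod]
    refine Finset.prod_le_prod (fun _ _ => abs_nonneg _) fun u _ => ?_
    have h3 : ∀ z, |f z| = 1 := by
      intro z
      rcases hf z with h | h <;> simp [h]
    rw [abs_mul, abs_mul, h3, mul_one, abs_of_nonneg (hμ.1 _), abs_of_nonneg (by positivity)]
    exact le_rfl
  · have h0 := vanish (d := d) (fun z => 2 ^ m * (μ z * f z)) (fun T hT => by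
        have := horth T hT
        simp_rw [mul_assoc] at this ⊢
        rw [← Finset.mul_sum, this, mul_zero]) q B (by omega) (fun _ => false) hq
    have h1 : 𝔼 x : Fin m → (Fin K → Fin ℓ) → Bool, ∏ u : Fin K → Bool,
      (2 ^ m * (μ (mask x (sel u S T)) * f (mask x (sel u S T)))) = 0 := by
      rw [Fintype.expect_eq_sum_div_card, div_eq_zero_iff]
      exact Or.inl h0
    rw [h1, abs_zero]
    exact Finset.sum_nonneg fun A _ => hterm A

lemma eq_prob {K ℓ m : ℕ} (hℓ : 0 < ℓ) (A : Finset (Fin K × Fin m)) (S : Fin K → Fin m → Fin ℓ) :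
    𝔼 T : Fin K → Fin m → Fin ℓ, ∏ p ∈ A, (if S p.1 p.2 = T p.1 p.2 then (1 : ℝ) else 0) =
      (1 / (ℓ : ℝ)) ^ A.card := by
  have : Nonempty (Fin ℓ) := ⟨⟨0, hℓ⟩⟩
  let H : Fin K → Fin m → Fin ℓ → ℝ := fun i α b =>
    if (i, α) ∈ A then (if S i α = b then (1 : ℝ) else 0) else 1
  let F : Fin K → (Fin m → Fin ℓ) → ℝ := fun i t => ∏ α, H i α (t α)
  have h1 : ∀ T : Fin K → Fin m → Fin ℓ,
      ∏ p ∈ A, (if S p.1 p.2 = T p.1 p.2 then (1 : ℝ) else 0) =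
      ∏ i, F i (T i) := by
    intro T
    simp only [F, H]
    rw [← Fintype.prod_prod_type' (fun (i : Fin K) (α : Fin m) =>
      if (i, α) ∈ A then (if S i α = T i α then (1 : ℝ) else 0) else 1)]
    rw [Finset.prod_ite_mem]; simp
  rw [Finset.expect_congr rfl (fun T _ => h1 T), exp_pi,
    Finset.prod_congr rfl (fun i _ => exp_pi (H i)), ← Fintype.prod_prod_type' (fun (i : Fin K) (α : Fin m) =>
      𝔼 b : Fin ℓ, if (i, α) ∈ A then (if S i α = b then (1 : ℝ) else 0) else 1)]
  have h2 : ∀ p : Fin K × Fin m,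
      (𝔼 b : Fin ℓ, if (p.1, p.2) ∈ A then (if S p.1 p.2 = b then (1 : ℝ) else 0) else 1) =
      if p ∈ A then 1 / (ℓ : ℝ) else 1 := by
    intro p
    split_ifs
    · simp [Fintype.expect_eq_sum_div_card]
    · simp
  rw [Finset.prod_congr rfl (fun p _ => h2 p), Finset.prod_ite_mem]
  simp

lemma final_sum {K ℓ m d : ℕ} (hℓ : 2 ≤ ℓ) :
    𝔼 S : Fin K → Fin m → Fin ℓ, 𝔼 T : Fin K → Fin m → Fin ℓ,
    (∑ A : Finset (Fin K × Fin m), if d ≤ A.card then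
      ((2 : ℝ) ^ (2 ^ K - 1)) ^ A.card *
        ∏ p ∈ A, (if S p.1 p.2 = T p.1 p.2 then (1 : ℝ) else 0) else 0) ≤
      ∑ j ∈ Finset.Icc d (K * m),
        (Nat.choose (K * m) j : ℝ) *
          ((2 : ℝ) ^ (2 ^ K - 1) / ((ℓ : ℝ) - 1)) ^ j := by
  have : Nonempty (Fin ℓ) := ⟨⟨0, by omega⟩⟩
  have hl : (2 : ℝ) ≤ ℓ := by exact_mod_cast hℓ
  have h1 : ∀ S : Fin K → Fin m → Fin ℓ, 𝔼 T : Fin K → Fin m → Fin ℓ,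
    (∑ A : Finset (Fin K × Fin m), if d ≤ A.card then
      ((2 : ℝ) ^ (2 ^ K - 1)) ^ A.card *
        ∏ p ∈ A, (if S p.1 p.2 = T p.1 p.2 then (1 : ℝ) else 0) else 0) =
      ∑ A : Finset (Fin K × Fin m), (fun j => if d ≤ j then ((2 : ℝ) ^ (2 ^ K - 1) / ℓ) ^ j else 0) A.card := by
    intro S
    rw [Finset.expect_sum_comm]
    refine Finset.sum_congr rfl fun A _ => ?_
    by_cases h : d ≤ A.card
    · simp only [h, if_true]
      rw [← Finset.mul_expect, eq_prob (by omega), ← mul_pow, mul_one_div]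
    · simp [h]
  rw [Finset.expect_congr rfl (fun S _ => h1 S), Fintype.expect_const, ← Finset.powerset_univ,
    Finset.sum_powerset_apply_card
      (fun j => if d ≤ j then ((2 : ℝ) ^ (2 ^ K - 1) / ℓ) ^ j else 0)]
  simp only [Finset.card_univ, Fintype.card_prod, Fintype.card_fin, nsmul_eq_mul, mul_ite, mul_zero]
  rw [← Finset.sum_filter]
  have h2 : (Finset.range (K * m + 1)).filter (fun j => d ≤ j) = Finset.Icc d (K * m) := by
    ext j; simp; omega
  rw [h2]
  refine Finset.sum_le_sum fun j _ => ?_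
  have : (0 : ℝ) < ℓ - 1 := by linarith
  gcongr
  linarith

lemma core {K ℓ m d : ℕ} (hK : 1 ≤ K) (hℓ : 2 ≤ ℓ) (μ : (Fin m → Bool) → ℝ) (hμ : IsProbDist μ)
    (f : (Fin m → Bool) → ℝ) (hf : ∀ z, f z = 1 ∨ f z = -1) (horth : Orthogonal μ d f)
    (φ : (Fin m → (Fin K → Fin ℓ) → Bool) × (Fin K → Fin m → Fin ℓ) → Bool)
    (hφ : IsCylinderIntersection φ) :
    |∑ y, μ (mask y.1 y.2) / ((ℓ : ℝ) ^ (m * K) * 2 ^ (ℓ ^ K * m - m)) * Ffun f y * bval (φ y)| ^ (2 ^ K)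
      ≤ 𝔼 S : Fin K → Fin m → Fin ℓ, 𝔼 T : Fin K → Fin m → Fin ℓ,
    (∑ A : Finset (Fin K × Fin m), if d ≤ A.card then
      ((2 : ℝ) ^ (2 ^ K - 1)) ^ A.card *
        ∏ p ∈ A, (if S p.1 p.2 = T p.1 p.2 then (1 : ℝ) else 0) else 0) := by
  obtain ⟨ψ₀, ψ, h0, h1, h2⟩ := hφ
  let x0 : Fin m → (Fin K → Fin ℓ) → Bool := fun _ _ => false
  let G : (Fin m → (Fin K → Fin ℓ) → Bool) → (Fin K → Fin m → Fin ℓ) → ℝ := fun x S =>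
    (2 ^ m * (μ (mask x S) * f (mask x S))) * bval (ψ₀ (x0, S))
  have hb : ∀ b, |bval b| ≤ 1 := by intro b; cases b <;> simp [bval]
  have e1 : ∑ y, μ (mask y.1 y.2) / ((ℓ : ℝ) ^ (m * K) * 2 ^ (ℓ ^ K * m - m)) * Ffun f y * bval (φ y) =
      𝔼 x, 𝔼 S, G x S * ∏ i, bval (ψ i (x, S)) := by
    rw [← exp_prod (fun y : (Fin m → (Fin K → Fin ℓ) → Bool) × (Fin K → Fin m → Fin ℓ) =>
      G y.1 y.2 * ∏ i, bval (ψ i (y.1, y.2))), Fintype.expect_eq_sum_div_card, Finset.sum_div]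
    refine Finset.sum_congr rfl fun y _ => ?_
    have e2 : bval (φ y) = bval (ψ₀ (x0, y.2)) * ∏ i, bval (ψ i (y.1, y.2)) := by
      rw [h2, h0 x0 y.1 y.2]
      have : ∏ i, bval (ψ i (y.1, y.2)) = bval (decide (∀ i, ψ i y = true)) := by
        by_cases h : ∀ i, ψ i y = true
        · simp [h, bval]
        · have h' := h
          push Not at h'
          obtain ⟨i, hi⟩ := h'
          rw [Finset.prod_eq_zero (Finset.mem_univ i) (by simp [bval, hi])]
          simp [h, bval]
      rw [this]
      cases ψ₀ y <;> simp [bval]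
    rw [e2]
    have e3 : (Fintype.card ((Fin m → (Fin K → Fin ℓ) → Bool) × (Fin K → Fin m → Fin ℓ)) : ℝ) =
        (ℓ : ℝ) ^ (m * K) * 2 ^ (ℓ ^ K * m - m) * 2 ^ m := by
      have : m ≤ ℓ ^ K * m := Nat.le_mul_of_pos_left _ (by positivity)
      rw [mul_assoc, ← pow_add, Nat.sub_add_cancel this]
      have e4 : Fintype.card ((Fin m → (Fin K → Fin ℓ) → Bool) × (Fin K → Fin m → Fin ℓ)) =
          ℓ ^ (m * K) * 2 ^ (ℓ ^ K * m) := by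
        simp only [Fintype.card_prod, Fintype.card_fun, Fintype.card_fin, Fintype.card_bool, pow_mul]
        ring
      rw [e4]
      push_cast
      rfl
    rw [e3]
    have : (ℓ : ℝ) ≠ 0 := by
      have : ℓ ≠ 0 := by omega
      exact_mod_cast this
    simp only [G, Ffun]
    field_simp
  rw [e1]
  rw [Even.pow_abs (Nat.even_pow.mpr ⟨by decide, by omega⟩)]
  refine (bns K _ G (fun i x S => bval (ψ i (x, S))) (fun i x S => hb _)
    (fun i x S S' h => by simp only [h1 i x S S' h])).trans ?_
  rw [exp_comm]
  refine Finset.expect_le_expect fun S _ => ?_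
  rw [exp_comm]
  refine Finset.expect_le_expect fun T _ => ?_
  refine le_trans ?_ (inner_bound μ hμ f hf horth S T)
  simp only [G, Finset.prod_mul_distrib (g := fun u => bval (ψ₀ (x0, sel u S T)))]
  rw [← Finset.expect_mul]
  refine (le_abs_self _).trans ?_
  rw [abs_mul]
  refine mul_le_of_le_one_right (abs_nonneg _) ?_
  rw [Finset.abs_prod]
  exact Finset.prod_le_one (fun _ _ => abs_nonneg _) fun _ _ => hb _

/-- Orthogonality–Discrepancy Lemma, main inequality:
`(disc_{k,λ}(F^f_k))^{2^{k-1}} ≤ Σ_{j=d}^{(k-1)m} C((k-1)m, j) (2^{2^{k-1}-1}/(ℓ-1))^j`. -/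
theorem statement3 (k ℓ m d : ℕ) (hk : 2 ≤ k) (hℓ : 2 ≤ ℓ) (hm : 1 ≤ m) (hd : 1 ≤ d)
    (n : ℕ) (hn : n = ℓ ^ (k - 1) * m)
    (μ : (Fin m → Bool) → ℝ) (hμ : IsProbDist μ)
    (f : (Fin m → Bool) → ℝ) (hf : ∀ z, f z = 1 ∨ f z = -1)
    (horth : Orthogonal μ d f) :
    (disc (lamDist k ℓ m n μ) (Ffun f)) ^ (2 ^ (k - 1)) ≤
      ∑ j ∈ Finset.Icc d ((k - 1) * m),
        (Nat.choose ((k - 1) * m) j : ℝ) *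
          ((2 : ℝ) ^ (2 ^ (k - 1) - 1) / ((ℓ : ℝ) - 1)) ^ j := by
  have hR : (0 : ℝ) ≤ ∑ j ∈ Finset.Icc d ((k - 1) * m),
        (Nat.choose ((k - 1) * m) j : ℝ) *
          ((2 : ℝ) ^ (2 ^ (k - 1) - 1) / ((ℓ : ℝ) - 1)) ^ j := by
    have hl : (2 : ℝ) ≤ ℓ := by exact_mod_cast hℓ
    have : (0 : ℝ) < ℓ - 1 := by linarith
    positivity
  have key : ∀ t ∈ { t | ∃ φ, IsCylinderIntersection φ ∧
      t = discPhi (lamDist k ℓ m n μ) (Ffun f) φ }, t ^ (2 ^ (k - 1)) ≤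
      ∑ j ∈ Finset.Icc d ((k - 1) * m), (Nat.choose ((k - 1) * m) j : ℝ) *
          ((2 : ℝ) ^ (2 ^ (k - 1) - 1) / ((ℓ : ℝ) - 1)) ^ j := by
    rintro t ⟨φ, hφ, rfl⟩
    subst hn
    exact (core (d := d) (by omega) hℓ μ hμ f hf horth φ hφ).trans (final_sum hℓ)
  have hnn : ∀ t ∈ { t | ∃ φ, IsCylinderIntersection φ ∧
      t = discPhi (lamDist k ℓ m n μ) (Ffun f) φ }, 0 ≤ t := by
    rintro t ⟨φ, hφ, rfl⟩
    exact abs_nonneg _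
  generalize (∑ j ∈ Finset.Icc d ((k - 1) * m), (Nat.choose ((k - 1) * m) j : ℝ) *
          ((2 : ℝ) ^ (2 ^ (k - 1) - 1) / ((ℓ : ℝ) - 1)) ^ j) = R at hR key ⊢
  have hN : (2 ^ (k - 1) : ℕ) ≠ 0 := by positivity
  have hR' : (R ^ (((2 ^ (k - 1) : ℕ) : ℝ)⁻¹)) ^ (2 ^ (k - 1)) = R := Real.rpow_inv_natCast_pow hR hN
  have h0 : 0 ≤ R ^ (((2 ^ (k - 1) : ℕ) : ℝ)⁻¹) := Real.rpow_nonneg hR _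
  have h1 : disc (lamDist k ℓ m n μ) (Ffun f) ≤ R ^ (((2 ^ (k - 1) : ℕ) : ℝ)⁻¹) := by
    refine Real.sSup_le (fun t ht => ?_) h0
    refine le_of_pow_le_pow_left₀ hN h0 ?_
    rw [hR']
    exact key t ht
  have h2 : 0 ≤ disc (lamDist k ℓ m n μ) (Ffun f) := Real.sSup_nonneg hnn
  exact (pow_le_pow_left₀ h2 h1 _).trans hR'.le
end

section
/- (Discrepancy form of the Main Theorem.) Let k ≥ 2 and m ≥ 1 be integers, 0 ≤ δ < 1, and let f : {0,1}^m → {−1,1} have δ-approximate degree equal to d with d > 2. Let ℓ be an integer with ℓ − 1 ≥ 2^{2^k}(k−1)e·m/d (e being Euler's number) and n = ℓ^{k−1}m. Then there exist a function g : {0,1}^m → {−1,1} and a probability distribution λ on {0,1}^n × ([ℓ]^m)^{k−1} such that Corr_λ(F^f_k, F^g_k) > δ and disc_{k,λ}(F^g_k) ≤ 2^{−d/2^{k−1}}. -/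
open scoped BigOperators

/-- `φ : {0,1}^m → ℝ` is (the evaluation of) a multilinear real polynomial of degree
at most `d`: a linear combination of the characters `χ_S` with `|S| ≤ d`. -/
def DegLE (m d : ℕ) (φ : (Fin m → Bool) → ℝ) : Prop :=
  ∃ c : Finset (Fin m) → ℝ,
    ∀ z, φ z = ∑ S ∈ Finset.univ.filter (fun S : Finset (Fin m) => S.card ≤ d),
      c S * chiChar S z

/-- The `δ`-approximate degree of `f`: the least `d` such that some multilinear real
polynomial `φ` of degree at most `d` satisfies `|f(x) − φ(x)| ≤ δ` for all `x`. -/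
noncomputable def approxDeg (m : ℕ) (δ : ℝ) (f : (Fin m → Bool) → ℝ) : ℕ :=
  sInf { d | ∃ φ, DegLE m d φ ∧ ∀ z, |f z - φ z| ≤ δ }


lemma chi_sq_sum {m : ℕ} (z w : Fin m → Bool) :
    ∑ T : Finset (Fin m), chiChar T z * chiChar T w = if z = w then (2:ℝ)^m else 0 := by
  have h1 : ∀ T : Finset (Fin m), chiChar T z * chiChar T w
      = ∏ i ∈ T, (if z i = w i then (1:ℝ) else -1) := by
    intro T
    unfold chiChar
    rw [← Finset.prod_mul_distrib]
    refine Finset.prod_congr rfl fun i _ => ?_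
    cases z i <;> cases w i <;> simp
  simp_rw [h1]
  rw [← Finset.powerset_univ, ← Finset.prod_one_add]
  split_ifs with h
  · subst h; norm_num
  · obtain ⟨i, hi⟩ := Function.ne_iff.1 h
    exact Finset.prod_eq_zero (Finset.mem_univ i) (by simp [hi])

lemma abs_chi {m : ℕ} (T : Finset (Fin m)) (z : Fin m → Bool) : |chiChar T z| = 1 := by
  unfold chiChar
  rw [Finset.abs_prod]
  refine Finset.prod_eq_one fun i _ => ?_
  split_ifs <;> simp

noncomputable def coef {m : ℕ} (ν : (Fin m → Bool) → ℝ) (T : Finset (Fin m)) : ℝ :=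
  ∑ w, ν w * chiChar T w

lemma fourier_exp {m : ℕ} (ν : (Fin m → Bool) → ℝ) (z : Fin m → Bool) :
    ν z = (2:ℝ)⁻¹ ^ m * ∑ T, coef ν T * chiChar T z := by
  unfold coef
  simp_rw [Finset.sum_mul]
  rw [Finset.sum_comm]
  have : ∀ w, ∑ T, ν w * chiChar T w * chiChar T z = if w = z then ν w * 2^m else 0 := by
    intro w
    simp_rw [mul_assoc]
    rw [← Finset.mul_sum, chi_sq_sum]
    split_ifs <;> simp
  simp_rw [this]
  simp
  field_simp

lemma coef_le {m : ℕ} (ν : (Fin m → Bool) → ℝ) (h : ∑ z, |ν z| = 1) (T : Finset (Fin m)) :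
    |coef ν T| ≤ 1 := by
  unfold coef
  refine (Finset.abs_sum_le_sum_abs _ _).trans ?_
  simp_rw [abs_mul, abs_chi, mul_one]
  exact h.le

lemma duality {m d : ℕ} (hd : 0 < d) (δ : ℝ) (hδ0 : 0 ≤ δ) (f : (Fin m → Bool) → ℝ)
    (hdeg : approxDeg m δ f = d) :
    ∃ ν : (Fin m → Bool) → ℝ, (∑ z, |ν z| = 1) ∧ (∀ T, T.card < d → coef ν T = 0) ∧
      δ < ∑ z, ν z * f z := by
  have hnot : (d - 1) ∉ { d | ∃ φ, DegLE m d φ ∧ ∀ z, |f z - φ z| ≤ δ } := by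
    apply Nat.notMem_of_lt_sInf
    change d - 1 < approxDeg m δ f
    omega
  let W : Submodule ℝ ((Fin m → Bool) → ℝ) :=
    Submodule.span ℝ ((fun T => chiChar T) '' {T : Finset (Fin m) | T.card ≤ d - 1})
  have hW : ∀ φ ∈ W, DegLE m (d-1) φ := by
    intro φ hφ
    induction hφ using Submodule.span_induction with
    | mem x hx =>
      obtain ⟨T, hT, rfl⟩ := hx
      refine ⟨fun S => if S = T then 1 else 0, fun z => ?_⟩
      have hT' : T.card ≤ d - 1 := hT
      simp [hT']
    | zero => exact ⟨0, by simp⟩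
    | add x y _ _ hx hy =>
      obtain ⟨c, hc⟩ := hx
      obtain ⟨c', hc'⟩ := hy
      exact ⟨c + c', fun z => by simp [hc, hc', add_mul, Finset.sum_add_distrib]⟩
    | smul a x _ hx =>
      obtain ⟨c, hc⟩ := hx
      exact ⟨a • c, fun z => by simp [hc, mul_assoc, Finset.mul_sum]⟩
  have hdisj : Disjoint (Metric.closedBall f δ) (W : Set ((Fin m → Bool) → ℝ)) := by
    rw [Set.disjoint_left]
    intro φ hφ hφW
    refine hnot ⟨φ, hW φ hφW, fun z => ?_⟩
    have := (dist_pi_le_iff hδ0).1 (Metric.mem_closedBall.1 hφ) z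
    rw [Real.dist_eq, abs_sub_comm] at this
    exact this
  obtain ⟨L, u, v, h1, huv, h2⟩ := geometric_hahn_banach_compact_closed
    (convex_closedBall f δ) (isCompact_closedBall f δ) W.convex W.closed_of_finiteDimensional hdisj
  have hv : v < 0 := by simpa using h2 0 W.zero_mem
  have hLW : ∀ w ∈ W, L w = 0 := by
    intro w hw
    by_contra hne
    have := h2 (((v - 1) / L w) • w) (W.smul_mem _ hw)
    rw [map_smul, smul_eq_mul, div_mul_cancel₀ _ hne] at this
    linarith
  let e : (Fin m → Bool) → ℝ := fun z => - L (Pi.single z 1)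
  have hL : ∀ a, ∑ z, e z * a z = - L a := by
    intro a
    conv_rhs => rw [← Finset.univ_sum_single a]
    rw [map_sum, ← Finset.sum_neg_distrib]
    refine Finset.sum_congr rfl fun z _ => ?_
    have : (Pi.single z (a z) : (Fin m → Bool) → ℝ) = a z • Pi.single z 1 := by
      rw [← Pi.single_smul]; simp
    rw [this, map_smul, smul_eq_mul]
    simp only [e]; ring
  have hpos : δ * ∑ z, |e z| < ∑ z, e z * f z := by
    let a : (Fin m → Bool) → ℝ := fun z => f z - δ * SignType.sign (e z)
    have ha : a ∈ Metric.closedBall f δ := by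
      rw [Metric.mem_closedBall, dist_pi_le_iff hδ0]
      intro z
      rw [Real.dist_eq]
      simp only [a, sub_sub_cancel_left, abs_neg, abs_mul, abs_of_nonneg hδ0]
      have : |((SignType.sign (e z) : SignType) : ℝ)| ≤ 1 := by
        rcases lt_trichotomy (e z) 0 with h | h | h <;> simp [h]
      nlinarith
    have h3 := h1 a ha
    have h4 := hL a
    have h5 : ∑ z, e z * a z = ∑ z, e z * f z - δ * ∑ z, |e z| := by
      rw [Finset.mul_sum, ← Finset.sum_sub_distrib]
      refine Finset.sum_congr rfl fun z _ => ?_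
      simp only [a]
      rw [← self_mul_sign]; ring
    linarith
  have hne : 0 < ∑ z, |e z| := by
    rcases (Finset.sum_nonneg (fun z _ => abs_nonneg (e z)) : 0 ≤ ∑ z, |e z|).eq_or_lt with h | h
    · exfalso
      have h0 : ∀ z, e z = 0 := by
        intro z
        have := (Finset.sum_eq_zero_iff_of_nonneg (fun z _ => abs_nonneg (e z))).1 h.symm z
          (Finset.mem_univ z)
        simpa using this
      simp [h0] at hpos
    · exact h
  set s := ∑ z, |e z| with hs
  refine ⟨fun z => e z / s, ?_, ?_, ?_⟩
  · simp_rw [abs_div, abs_of_pos hne]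
    rw [← Finset.sum_div, ← hs, div_self hne.ne']
  · intro T hT
    unfold coef
    have : ∑ z, e z * chiChar T z = 0 := by
      rw [hL, hLW _ (Submodule.subset_span ⟨T, by simp; omega, rfl⟩), neg_zero]
    simp_rw [div_mul_eq_mul_div]
    rw [← Finset.sum_div, this, zero_div]
  · simp_rw [div_mul_eq_mul_div]
    rw [← Finset.sum_div, lt_div_iff₀ hne]
    exact hpos

lemma card_fix {C : Type*} [Fintype C] [DecidableEq C] (c : C) (b : Bool) :
    (Finset.univ.filter (fun y : C → Bool => y c = b)).card = 2 ^ (Fintype.card C - 1) := by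
  have : Finset.univ.filter (fun y : C → Bool => y c = b)
      = Fintype.piFinset (fun j => if j = c then {b} else Finset.univ) := by
    ext y
    simp only [Finset.mem_filter, Finset.mem_univ, true_and, Fintype.mem_piFinset]
    constructor
    · intro h j
      split_ifs with hj
      · subst hj; simpa using h
      · simp
    · intro h
      simpa using h c
  rw [this, Fintype.card_piFinset, ← Finset.mul_prod_erase _ _ (Finset.mem_univ c)]
  rw [Finset.prod_congr rfl (g := fun _ => 2)]
  · simp [Finset.card_erase_of_mem]
  · intro j hj
    simp [Finset.ne_of_mem_erase hj]

lemma sum_mask {K ℓ m : ℕ} (S : Fin K → Fin m → Fin ℓ) (F : (Fin m → Bool) → ℝ) :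
    ∑ x : Fin m → (Fin K → Fin ℓ) → Bool, F (mask x S)
      = (2 ^ (ℓ ^ K - 1)) ^ m * ∑ z, F z := by
  have hc : ∀ z : Fin m → Bool, (Finset.univ.filter
      (fun x : Fin m → (Fin K → Fin ℓ) → Bool => mask x S = z)).card = (2 ^ (ℓ ^ K - 1)) ^ m := by
    intro z
    have : Finset.univ.filter (fun x : Fin m → (Fin K → Fin ℓ) → Bool => mask x S = z)
      = Fintype.piFinset (fun α => Finset.univ.filter
          (fun y : (Fin K → Fin ℓ) → Bool => y (fun i => S i α) = z α)) := by
      ext x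
      simp [funext_iff, mask]
    rw [this, Fintype.card_piFinset]
    simp only [card_fix]
    simp
  rw [← Finset.sum_fiberwise (s := Finset.univ) (g := fun x => mask x S)]
  rw [Finset.mul_sum]
  refine Finset.sum_congr rfl fun z _ => ?_
  rw [Finset.sum_congr rfl (g := fun _ => F z)]
  · rw [Finset.sum_const, hc]; simp
  · intro x hx
    rw [(Finset.mem_filter.1 hx).2]

lemma jensen_sum {ι : Type*} [Fintype ι] (f : ι → ℝ) (P : ℕ) (hP : 0 < P) :
    |∑ i, f i| ^ P * (Fintype.card ι : ℝ) ≤ (Fintype.card ι : ℝ) ^ P * ∑ i, |f i| ^ P := by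
  obtain ⟨n, rfl⟩ : ∃ n, P = n + 1 := ⟨P - 1, by omega⟩
  rcases Nat.eq_zero_or_pos (Fintype.card ι) with h | h
  · simp [h]
  have h' : (0:ℝ) < Fintype.card ι := by exact_mod_cast h
  have h1 := pow_sum_div_card_le_sum_pow (s := Finset.univ) (f := fun i => |f i|)
    (fun i _ => abs_nonneg _) n
  rw [Finset.card_univ, div_le_iff₀ (by positivity)] at h1
  have h2 : |∑ i, f i| ^ (n+1) ≤ (∑ i, |f i|) ^ (n+1) :=
    pow_le_pow_left₀ (abs_nonneg _) (Finset.abs_sum_le_sum_abs _ _) _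
  calc _ ≤ (∑ i, |f i| ^ (n+1)) * (Fintype.card ι : ℝ) ^ n * Fintype.card ι := by
        gcongr; exact h2.trans h1
    _ = _ := by ring

lemma jensen_sum' {ι : Type*} [Fintype ι] (f : ι → ℝ) (K : ℕ) :
    (∑ i, f i) ^ (2 ^ K) * (Fintype.card ι : ℝ) ≤
      (Fintype.card ι : ℝ) ^ (2 ^ K) * ∑ i, (f i) ^ (2 ^ K) := by
  rcases Nat.eq_zero_or_pos K with rfl | hK
  · simp [mul_comm]
  · have he : Even (2 ^ K) := (Nat.even_pow.2 ⟨even_two, hK.ne'⟩)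
    have := jensen_sum f (2 ^ K) (by positivity)
    simpa only [he.pow_abs] using this

/-- choose a point of the box -/
def pick {K : ℕ} {V : Type*} (P : Fin K → V × V) (u : Fin K → Bool) : Fin K → V :=
  fun i => if u i then (P i).2 else (P i).1

lemma sum_cons {K : ℕ} {V : Type*} [Fintype V] (F : (Fin (K+1) → V) → ℝ) :
    ∑ S, F S = ∑ v, ∑ S : Fin K → V, F (Fin.cons v S) := by
  rw [← Fintype.sum_prod_type']
  exact (Equiv.sum_comp (Fin.consEquiv (fun _ => V)) F).symm

lemma prod_cons {K : ℕ} (F : (Fin (K+1) → Bool) → ℝ) :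
    ∏ S, F S = ∏ u : Fin K → Bool, (F (Fin.cons false u) * F (Fin.cons true u)) := by
  rw [← Equiv.prod_comp (Fin.consEquiv (fun _ => Bool)) F, Fintype.prod_prod_type_right]
  refine Finset.prod_congr rfl fun u _ => ?_
  simp [Fin.consEquiv, mul_comm]

lemma gcs {V : Type*} [Fintype V] : ∀ (K : ℕ) (h : (Fin K → V) → ℝ)
    (ψ : Fin K → (Fin K → V) → ℝ) (_ : ∀ i S, |ψ i S| ≤ 1)
    (_ : ∀ i S S', (∀ j, j ≠ i → S j = S' j) → ψ i S = ψ i S'),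
    (∑ S, h S * ∏ i, ψ i S) ^ (2 ^ K) * (Fintype.card V : ℝ) ^ (2 * K) ≤
      (Fintype.card V : ℝ) ^ (K * 2 ^ K) * ∑ P : Fin K → V × V, ∏ u, h (pick P u) := by
  intro K
  induction K with
  | zero =>
    intro h ψ _ _
    simp [Subsingleton.elim _ (fun i : Fin 0 => (Fin.elim0 i : V))]
  | succ K ih =>
    intro h ψ hb hψ
    set N : ℝ := (Fintype.card V : ℝ) with hN
    have hN0 : 0 ≤ N := by positivity
    let Y : V × V → ℝ := fun vv => ∑ S : Fin K → V,
      (h (Fin.cons vv.1 S) * h (Fin.cons vv.2 S)) *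
        ∏ i : Fin K, (ψ i.succ (Fin.cons vv.1 S) * ψ i.succ (Fin.cons vv.2 S))
    have hY : ∀ vv, (Y vv) ^ (2 ^ K) * N ^ (2 * K) ≤ N ^ (K * 2 ^ K) *
        ∑ P : Fin K → V × V, ∏ u, (h (Fin.cons vv.1 (pick P u)) * h (Fin.cons vv.2 (pick P u))) := by
      intro vv
      refine ih (fun S => h (Fin.cons vv.1 S) * h (Fin.cons vv.2 S))
        (fun i S => ψ i.succ (Fin.cons vv.1 S) * ψ i.succ (Fin.cons vv.2 S)) ?_ ?_
      · intro i S
        rw [abs_mul]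
        exact mul_le_one₀ (hb _ _) (abs_nonneg _) (hb _ _)
      · intro i S S' hSS
        have : ∀ v : V, ψ i.succ (Fin.cons v S) = ψ i.succ (Fin.cons v S') := by
          intro v
          apply hψ
          intro j
          refine Fin.cases ?_ (fun j => ?_) j
          · intro _; rfl
          · intro hj
            simpa using hSS j (fun h => hj (by rw [h]))
        simp only [this]
    -- first Cauchy-Schwarz
    have hX : (∑ S, h S * ∏ i, ψ i S) ^ 2 ≤ N ^ K * ∑ vv, Y vv := by
      rcases isEmpty_or_nonempty V with hV | ⟨⟨v0⟩⟩
      · have : IsEmpty (Fin (K+1) → V) := ⟨fun S => hV.false (S 0)⟩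
        simp
      have e1 : ∑ S, h S * ∏ i, ψ i S = ∑ S : Fin K → V, ψ 0 (Fin.cons v0 S) *
          ∑ v, h (Fin.cons v S) * ∏ i : Fin K, ψ i.succ (Fin.cons v S) := by
        rw [sum_cons, Finset.sum_comm]
        refine Finset.sum_congr rfl fun S _ => ?_
        rw [Finset.mul_sum]
        refine Finset.sum_congr rfl fun v _ => ?_
        rw [Fin.prod_univ_succ]
        have : ψ 0 (Fin.cons v S) = ψ 0 (Fin.cons v0 S) := by
          apply hψ
          intro j
          refine Fin.cases ?_ (fun j => ?_) j
          · intro h; exact absurd rfl h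
          · intro _; simp
        rw [this]; ring
      rw [e1]
      refine (Finset.sum_mul_sq_le_sq_mul_sq _ _ _).trans ?_
      have e2 : ∑ S : Fin K → V, ψ 0 (Fin.cons v0 S) ^ 2 ≤ N ^ K := by
        calc _ ≤ ∑ S : Fin K → V, (1:ℝ) := Finset.sum_le_sum fun S _ => by
              rw [sq_le_one_iff_abs_le_one]; exact hb _ _
          _ = N ^ K := by simp [hN]
      have e3 : ∑ S : Fin K → V, (∑ v, h (Fin.cons v S) * ∏ i : Fin K, ψ i.succ (Fin.cons v S)) ^ 2
          = ∑ vv, Y vv := by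
        simp only [Y]
        rw [Finset.sum_comm]
        refine Finset.sum_congr rfl fun S _ => ?_
        rw [sq, Finset.sum_mul_sum, Fintype.sum_prod_type]
        refine Finset.sum_congr rfl fun v _ => Finset.sum_congr rfl fun v' _ => ?_
        rw [Finset.prod_mul_distrib]
        ring
      rw [e3]
      refine mul_le_mul_of_nonneg_right e2 ?_
      rw [← e3]
      positivity
    have hJ := jensen_sum' Y K
    have hc : (Fintype.card (V × V) : ℝ) = N ^ 2 := by simp [hN, sq]
    rw [hc] at hJ
    have hR : ∑ P : Fin (K+1) → V × V, ∏ u, h (pick P u)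
        = ∑ vv : V × V, ∑ P : Fin K → V × V,
          ∏ u, (h (Fin.cons vv.1 (pick P u)) * h (Fin.cons vv.2 (pick P u))) := by
      rw [sum_cons]
      refine Finset.sum_congr rfl fun vv _ => Finset.sum_congr rfl fun P _ => ?_
      rw [prod_cons]
      refine Finset.prod_congr rfl fun u _ => ?_
      congr 2 <;>
      · funext j
        refine Fin.cases ?_ (fun j => ?_) j <;> simp [pick]
    rw [hR]
    have hX2 : (∑ S, h S * ∏ i, ψ i S) ^ (2 ^ (K+1)) ≤ N ^ (K * 2 ^ K) * (∑ vv, Y vv) ^ (2 ^ K) := by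
      have : (∑ S, h S * ∏ i, ψ i S) ^ (2 ^ (K+1)) = ((∑ S, h S * ∏ i, ψ i S) ^ 2) ^ (2 ^ K) := by
        rw [← pow_mul]; congr 1; ring
      rw [this]
      calc _ ≤ (N ^ K * (∑ vv, Y vv)) ^ (2 ^ K) := by gcongr
        _ = _ := by rw [mul_pow, ← pow_mul]
    calc _ ≤ (N ^ (K * 2 ^ K) * (∑ vv, Y vv) ^ (2 ^ K)) * N ^ (2 * (K+1)) := by gcongr
      _ = N ^ (K * 2 ^ K) * N ^ (2 * K) * ((∑ vv, Y vv) ^ (2 ^ K) * N ^ 2) := by ring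
      _ ≤ N ^ (K * 2 ^ K) * N ^ (2 * K) * ((N ^ 2) ^ (2 ^ K) * ∑ vv, (Y vv) ^ (2 ^ K)) := by gcongr
      _ = N ^ (K * 2 ^ K) * (N ^ 2) ^ (2 ^ K) * ∑ vv, ((Y vv) ^ (2 ^ K) * N ^ (2 * K)) := by
          rw [← Finset.sum_mul]; ring
      _ ≤ N ^ (K * 2 ^ K) * (N ^ 2) ^ (2 ^ K) * ∑ vv : V × V, (N ^ (K * 2 ^ K) *
        ∑ P : Fin K → V × V,
          ∏ u, (h (Fin.cons vv.1 (pick P u)) * h (Fin.cons vv.2 (pick P u)))) := by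
          exact mul_le_mul_of_nonneg_left (Finset.sum_le_sum fun vv _ => hY vv) (by positivity)
      _ = _ := by
          rw [← Finset.mul_sum, ← mul_assoc]
          congr 1
          rw [← pow_mul, ← pow_add, ← pow_add]; congr 1; ring

/-- the bad blocks of a box -/
def badSet {K ℓ m : ℕ} (P : Fin K → (Fin m → Fin ℓ) × (Fin m → Fin ℓ)) : Finset (Fin m) :=
  Finset.univ.filter (fun α => ∃ i, (P i).1 α = (P i).2 α)

lemma char_sum_zero {K ℓ m : ℕ} (P : Fin K → (Fin m → Fin ℓ) × (Fin m → Fin ℓ))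
    (τ : (Fin K → Bool) → Finset (Fin m)) (u₀ : Fin K → Bool) (hτ : ¬ τ u₀ ⊆ badSet P) :
    ∑ x : Fin m → (Fin K → Fin ℓ) → Bool, ∏ u, chiChar (τ u) (mask x (pick P u)) = 0 := by
  classical
  obtain ⟨α, hα, hαb⟩ := Finset.not_subset.1 hτ
  have hgood : ∀ i, (P i).1 α ≠ (P i).2 α := by
    intro i h
    exact hαb (Finset.mem_filter.2 ⟨Finset.mem_univ _, i, h⟩)
  let c : Fin K → Fin ℓ := fun i => pick P u₀ i α
  let Φ : (Fin m → (Fin K → Fin ℓ) → Bool) → (Fin m → (Fin K → Fin ℓ) → Bool) :=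
    fun x => Function.update x α (Function.update (x α) c (!x α c))
  have hΦΦ : ∀ x, Φ (Φ x) = x := by
    intro x; simp [Φ]
  have h1 : ∀ x u, u ≠ u₀ → mask (Φ x) (pick P u) = mask x (pick P u) := by
    intro x u hu
    funext β
    unfold mask
    by_cases hβ : β = α
    · subst hβ
      have : (fun i => pick P u i β) ≠ c := by
        obtain ⟨i, hi⟩ := Function.ne_iff.1 hu
        intro h
        have := congrFun h i
        simp only [c, pick] at this
        have hg := hgood i
        cases h1 : u i <;> cases h2 : u₀ i <;> simp_all
      simp [Φ, this]
    · simp [Φ, hβ]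
  have h2 : ∀ x, mask (Φ x) (pick P u₀) α = ! (mask x (pick P u₀) α) := by
    intro x
    simp [mask, Φ, c]
  have h2' : ∀ x β, β ≠ α → mask (Φ x) (pick P u₀) β = mask x (pick P u₀) β := by
    intro x β hβ
    simp [mask, Φ, hβ]
  have h3 : ∀ x, chiChar (τ u₀) (mask (Φ x) (pick P u₀)) = - chiChar (τ u₀) (mask x (pick P u₀)) := by
    intro x
    unfold chiChar
    rw [← Finset.mul_prod_erase _ _ hα, ← Finset.mul_prod_erase _ _ hα, h2]
    rw [Finset.prod_congr rfl (g := fun i => if mask x (pick P u₀) i then (-1:ℝ) else 1)]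
    · cases mask x (pick P u₀) α <;> simp
    · intro β hβ
      rw [h2' x β (Finset.ne_of_mem_erase hβ)]
  refine Finset.sum_involution (fun x _ => Φ x) ?_ ?_ (fun _ _ => Finset.mem_univ _) (fun x _ => hΦΦ x)
  · intro x _
    rw [← Finset.mul_prod_erase _ _ (Finset.mem_univ u₀), ← Finset.mul_prod_erase _ _ (Finset.mem_univ u₀),
      h3]
    have h4 : ∏ u ∈ Finset.univ.erase u₀, chiChar (τ u) (mask (Φ x) (pick P u))
        = ∏ u ∈ Finset.univ.erase u₀, chiChar (τ u) (mask x (pick P u)) :=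
      Finset.prod_congr rfl (fun u hu => by rw [h1 x u (Finset.ne_of_mem_erase hu)])
    rw [h4]
    ring
  · intro x _ _ h
    have := h2 x
    rw [h] at this
    simp at this

lemma box_bound {K ℓ m d : ℕ} (ν : (Fin m → Bool) → ℝ) (hν : ∑ z, |ν z| = 1)
    (ho : ∀ T : Finset (Fin m), T.card < d → coef ν T = 0)
    (P : Fin K → (Fin m → Fin ℓ) × (Fin m → Fin ℓ)) :
    |∑ x : Fin m → (Fin K → Fin ℓ) → Bool, ∏ u, ν (mask x (pick P u))| ≤
      ((2:ℝ)⁻¹ ^ m) ^ (2 ^ K) *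
        (Fintype.card (Fin m → (Fin K → Fin ℓ) → Bool) : ℝ) *
        (((2:ℝ) ^ (2 ^ K)) ^ (2 * (badSet P).card) / ((2:ℝ) ^ (2 ^ K)) ^ d) := by
  classical
  set nX : ℝ := (Fintype.card (Fin m → (Fin K → Fin ℓ) → Bool) : ℝ) with hnX
  have e1 : ∑ x : Fin m → (Fin K → Fin ℓ) → Bool, ∏ u, ν (mask x (pick P u))
      = ((2:ℝ)⁻¹ ^ m) ^ (2 ^ K) * ∑ τ : (Fin K → Bool) → Finset (Fin m),
        (∏ u, coef ν (τ u)) * ∑ x : Fin m → (Fin K → Fin ℓ) → Bool,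
          ∏ u, chiChar (τ u) (mask x (pick P u)) := by
    simp_rw [Finset.mul_sum (s := (Finset.univ : Finset (Fin m → (Fin K → Fin ℓ) → Bool)))]
    rw [Finset.sum_comm, Finset.mul_sum]
    refine Finset.sum_congr rfl fun x _ => ?_
    rw [Finset.prod_congr rfl (fun u _ => fourier_exp ν (mask x (pick P u)))]
    rw [Finset.prod_mul_distrib, Finset.prod_const, Finset.card_univ, Fintype.prod_sum]
    congr 1
    · simp
    · exact Finset.sum_congr rfl fun τ _ => Finset.prod_mul_distrib
  have e2 : ∀ τ : (Fin K → Bool) → Finset (Fin m),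
      |(∏ u, coef ν (τ u)) * ∑ x : Fin m → (Fin K → Fin ℓ) → Bool,
          ∏ u, chiChar (τ u) (mask x (pick P u))| ≤
        nX * ∏ u, (if τ u ⊆ badSet P then |coef ν (τ u)| else 0) := by
    intro τ
    by_cases h : ∀ u, τ u ⊆ badSet P
    · rw [Finset.prod_congr rfl (fun u _ => if_pos (h u)), abs_mul, Finset.abs_prod, mul_comm]
      gcongr
      refine (Finset.abs_sum_le_sum_abs _ _).trans ?_
      simp [Finset.abs_prod, abs_chi, hnX]
    · push Not at h
      obtain ⟨u₀, hu₀⟩ := h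
      rw [char_sum_zero P τ u₀ hu₀, mul_zero, abs_zero]
      refine mul_nonneg (by positivity) (Finset.prod_nonneg fun u _ => ?_)
      split_ifs <;> positivity
  have e3 : ∑ T : Finset (Fin m), (if T ⊆ badSet P then |coef ν T| else 0) ≤
      if d ≤ (badSet P).card then (2:ℝ) ^ (badSet P).card else 0 := by
    split_ifs with h
    · calc _ ≤ ∑ T : Finset (Fin m), (if T ⊆ badSet P then (1:ℝ) else 0) := by
            refine Finset.sum_le_sum fun T _ => ?_
            split_ifs
            · exact coef_le ν hν T
            · exact le_rfl
        _ = (2:ℝ) ^ (badSet P).card := by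
            rw [Finset.sum_boole]
            have : Finset.univ.filter (fun T => T ⊆ badSet P) = (badSet P).powerset := by
              ext T; simp
            rw [this, Finset.card_powerset]; simp
    · refine le_of_eq (Finset.sum_eq_zero fun T _ => ?_)
      split_ifs with hT
      · rw [ho T (lt_of_le_of_lt (Finset.card_le_card hT) (not_le.1 h)), abs_zero]
      · rfl
  have e4 : ∏ _u : Fin K → Bool, ∑ T : Finset (Fin m), (if T ⊆ badSet P then |coef ν T| else 0) ≤
      ((2:ℝ) ^ (2 ^ K)) ^ (2 * (badSet P).card) / ((2:ℝ) ^ (2 ^ K)) ^ d := by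
    rw [Finset.prod_const, Finset.card_univ]
    have hc : Fintype.card (Fin K → Bool) = 2 ^ K := by simp
    rw [hc]
    refine (pow_le_pow_left₀ (Finset.sum_nonneg fun T _ => ?_) e3 _).trans ?_
    · split_ifs <;> positivity
    split_ifs with h
    · rw [le_div_iff₀ (by positivity)]
      calc ((2:ℝ) ^ (badSet P).card) ^ 2 ^ K * ((2:ℝ) ^ 2 ^ K) ^ d
          ≤ ((2:ℝ) ^ (badSet P).card) ^ 2 ^ K * ((2:ℝ) ^ 2 ^ K) ^ (badSet P).card := by
            gcongr
            exact one_le_pow₀ (by norm_num)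
        _ = _ := by
            rw [← pow_mul, ← pow_mul, ← pow_add, ← pow_mul]; congr 1; ring
    · rw [zero_pow (by positivity)]; positivity
  rw [e1, abs_mul, abs_of_nonneg (by positivity), mul_assoc]
  gcongr
  calc _ ≤ ∑ τ : (Fin K → Bool) → Finset (Fin m),
        nX * ∏ u, (if τ u ⊆ badSet P then |coef ν (τ u)| else 0) :=
        (Finset.abs_sum_le_sum_abs _ _).trans (Finset.sum_le_sum fun τ _ => e2 τ)
    _ = nX * ∏ _u : Fin K → Bool, ∑ T : Finset (Fin m), (if T ⊆ badSet P then |coef ν T| else 0) := by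
        rw [← Finset.mul_sum, Fintype.prod_sum]
    _ ≤ _ := by gcongr

lemma count_diag {K ℓ : ℕ} (i : Fin K) :
    ((Finset.univ.filter (fun q : Fin K → Fin ℓ × Fin ℓ => (q i).1 = (q i).2)).card : ℝ) * ℓ
      = (ℓ ^ 2) ^ K := by
  classical
  have : Finset.univ.filter (fun q : Fin K → Fin ℓ × Fin ℓ => (q i).1 = (q i).2)
      = Fintype.piFinset (fun j => if j = i then Finset.univ.filter
          (fun a : Fin ℓ × Fin ℓ => a.1 = a.2) else Finset.univ) := by
    ext y
    simp only [Finset.mem_filter, Finset.mem_univ, true_and, Fintype.mem_piFinset]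
    constructor
    · intro h j
      split_ifs with hj
      · subst hj; simpa using h
      · simp
    · intro h
      simpa using h i
  have hd : (Finset.univ.filter (fun a : Fin ℓ × Fin ℓ => a.1 = a.2)).card = ℓ := by
    have : Finset.univ.filter (fun a : Fin ℓ × Fin ℓ => a.1 = a.2) = Finset.univ.diag := by
      ext a; simp [Finset.mem_diag]
    rw [this, Finset.diag_card]; simp
  rw [this, Fintype.card_piFinset, ← Finset.mul_prod_erase _ _ (Finset.mem_univ i)]
  rw [Finset.prod_congr rfl (g := fun _ => ℓ ^ 2)]
  · have hK : 1 ≤ K := by have := i.2; omega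
    obtain ⟨K', rfl⟩ : ∃ K', K = K' + 1 := ⟨K - 1, by omega⟩
    simp [Finset.card_erase_of_mem, hd]
    ring
  · intro j hj
    simp [Finset.ne_of_mem_erase hj, sq]

lemma sum_bad {K ℓ m : ℕ} (hl : 0 < ℓ) (A : ℝ) (hA : 1 ≤ A) :
    ∑ P : Fin K → (Fin m → Fin ℓ) × (Fin m → Fin ℓ), A ^ (badSet P).card ≤
      (((ℓ:ℝ) ^ 2) ^ K) ^ m * Real.exp (A * K / ℓ * m) := by
  classical
  let c : (Fin K → Fin ℓ × Fin ℓ) → ℝ := fun q => if ∃ i, (q i).1 = (q i).2 then A else 1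
  let e : (Fin K → (Fin m → Fin ℓ) × (Fin m → Fin ℓ)) ≃ (Fin m → Fin K → Fin ℓ × Fin ℓ) :=
    { toFun := fun P α i => ((P i).1 α, (P i).2 α)
      invFun := fun Q i => (fun α => (Q α i).1, fun α => (Q α i).2)
      left_inv := fun P => rfl
      right_inv := fun Q => rfl }
  have h1 : ∀ P : Fin K → (Fin m → Fin ℓ) × (Fin m → Fin ℓ),
      A ^ (badSet P).card = ∏ α, c (e P α) := by
    intro P
    simp only [c, e, Equiv.coe_fn_mk]
    rw [Finset.prod_ite, Finset.prod_const, Finset.prod_const_one, mul_one]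
    rfl
  simp_rw [h1]
  rw [Equiv.sum_comp e (fun Q => ∏ α, c (Q α)), ← Fintype.prod_sum, Finset.prod_const,
    Finset.card_univ, Fintype.card_fin]
  have hl' : (0:ℝ) < ℓ := by exact_mod_cast hl
  have h2 : ∑ q, c q ≤ ((ℓ:ℝ) ^ 2) ^ K * Real.exp (A * K / ℓ) := by
    calc ∑ q, c q ≤ ∑ q : Fin K → Fin ℓ × Fin ℓ,
          (1 + A * ∑ i, if (q i).1 = (q i).2 then (1:ℝ) else 0) := by
          refine Finset.sum_le_sum fun q _ => ?_
          have hnn : ∀ i ∈ (Finset.univ : Finset (Fin K)),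
            (0:ℝ) ≤ if (q i).1 = (q i).2 then (1:ℝ) else 0 := by
            intro i _; split_ifs <;> norm_num
          simp only [c]
          split_ifs with h
          · obtain ⟨i, hi⟩ := h
            have := Finset.single_le_sum hnn (Finset.mem_univ i)
            rw [if_pos hi] at this
            nlinarith
          · have := Finset.sum_nonneg hnn
            nlinarith
      _ = ((ℓ:ℝ) ^ 2) ^ K * (A * K / ℓ + 1) := by
          rw [Finset.sum_add_distrib, ← Finset.mul_sum, Finset.sum_comm]
          have : ∀ i : Fin K, ∑ q : Fin K → Fin ℓ × Fin ℓ,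
              (if (q i).1 = (q i).2 then (1:ℝ) else 0) = ((ℓ:ℝ) ^ 2) ^ K / ℓ := by
            intro i
            rw [Finset.sum_boole, eq_div_iff hl'.ne']
            exact count_diag i
          simp_rw [this]
          simp [sq]
          field_simp
          ring
      _ ≤ _ := by gcongr; exact Real.add_one_le_exp _
  calc (∑ q, c q) ^ m ≤ (((ℓ:ℝ) ^ 2) ^ K * Real.exp (A * K / ℓ)) ^ m := by
        refine pow_le_pow_left₀ (Finset.sum_nonneg fun q _ => ?_) h2 _
        simp only [c]; split_ifs <;> linarith
    _ = _ := by rw [mul_pow, ← Real.exp_nat_mul]; congr 2; ring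

lemma exp_bound {K ℓ m d : ℕ} (hK : 1 ≤ K) (hd : 0 < d) (hl : 0 < ℓ)
    (hℓ : ((2:ℝ) ^ (2 ^ K)) ^ 2 * K * Real.exp 1 * m / d ≤ (ℓ : ℝ)) :
    Real.exp (((2:ℝ) ^ (2 ^ K)) ^ 2 * K / ℓ * m) / ((2:ℝ) ^ (2 ^ K)) ^ d ≤ (2:ℝ)⁻¹ ^ d := by
  have hl' : (0:ℝ) < ℓ := by exact_mod_cast hl
  have hd' : (0:ℝ) < d := by exact_mod_cast hd
  set A := ((2:ℝ) ^ (2 ^ K)) ^ 2 * K * m with hA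
  have hA0 : 0 ≤ A := by positivity
  have h1 : A / ℓ ≤ d * Real.log 2 := by
    rw [div_le_iff₀ hl']
    rw [div_le_iff₀ hd'] at hℓ
    have h2 := Real.exp_one_gt_d9
    have h3 := Real.log_two_gt_d9
    have h4 : A * 2 ≤ ℓ * d := by
      calc A * 2 ≤ A * Real.exp 1 := by gcongr; linarith
        _ = ((2:ℝ) ^ (2 ^ K)) ^ 2 * K * Real.exp 1 * m := by rw [hA]; ring
        _ ≤ _ := hℓ
    have h5 : (0:ℝ) < ℓ * d := by positivity
    nlinarith
  have h2 : Real.exp (((2:ℝ) ^ (2 ^ K)) ^ 2 * K / ℓ * m) ≤ 2 ^ d := by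
    calc _ = Real.exp (A / ℓ) := by rw [hA]; congr 1; ring
      _ ≤ Real.exp (d * Real.log 2) := by gcongr
      _ = 2 ^ d := by rw [Real.exp_nat_mul, Real.exp_log (by norm_num)]
  have h3 : (4:ℝ) ≤ 2 ^ (2 ^ K) := by
    have : 2 ≤ 2 ^ K := by
      calc 2 = 2 ^ 1 := rfl
        _ ≤ 2 ^ K := Nat.pow_le_pow_right (by norm_num) hK
    calc (4:ℝ) = 2 ^ 2 := by norm_num
      _ ≤ _ := pow_le_pow_right₀ (by norm_num) this
  rw [div_le_iff₀ (by positivity)]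
  calc _ ≤ (2:ℝ) ^ d := h2
    _ = (2:ℝ)⁻¹ ^ d * 4 ^ d := by rw [← mul_pow]; norm_num
    _ ≤ _ := by gcongr

lemma disc_core {K ℓ m d : ℕ} (hK : 1 ≤ K) (hd : 0 < d) (hl : 0 < ℓ)
    (hℓ : ((2:ℝ) ^ (2 ^ K)) ^ 2 * K * Real.exp 1 * m / d ≤ (ℓ : ℝ))
    (ν : (Fin m → Bool) → ℝ) (hν : ∑ z, |ν z| = 1)
    (ho : ∀ T : Finset (Fin m), T.card < d → coef ν T = 0)
    (φ : (Fin m → (Fin K → Fin ℓ) → Bool) × (Fin K → Fin m → Fin ℓ) → Bool)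
    (hφ : IsCylinderIntersection φ) :
    |∑ p, ν (mask p.1 p.2) * bval (φ p)| ≤
      (Fintype.card (Fin m → (Fin K → Fin ℓ) → Bool) : ℝ) *
        ((ℓ:ℝ) ^ m) ^ K * (2:ℝ)⁻¹ ^ m * (2:ℝ) ^ (-(d:ℝ) / 2 ^ K) := by
  classical
  obtain ⟨ψ₀, ψ, hψ₀, hψ, hφe⟩ := hφ
  set nX : ℝ := (Fintype.card (Fin m → (Fin K → Fin ℓ) → Bool) : ℝ) with hnX
  have hnX0 : 0 < nX := by rw [hnX]; exact_mod_cast Fintype.card_pos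
  have hl' : (0:ℝ) < ℓ := by exact_mod_cast hl
  set N : ℝ := (ℓ:ℝ) ^ m with hN
  have hN0 : 0 < N := by positivity
  have hcard : (Fintype.card (Fin m → Fin ℓ) : ℝ) = N := by simp [hN]
  let b0 : (Fin K → Fin m → Fin ℓ) → ℝ := fun S => bval (ψ₀ (fun _ _ => false, S))
  have hbv : ∀ b, |bval b| ≤ 1 := by intro b; cases b <;> simp [bval]
  let D : (Fin m → (Fin K → Fin ℓ) → Bool) → ℝ := fun x =>
    ∑ S, (ν (mask x S) * b0 S) * ∏ i, bval (ψ i (x, S))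
  have hsum : ∑ p, ν (mask p.1 p.2) * bval (φ p) = ∑ x, D x := by
    rw [Fintype.sum_prod_type]
    refine Finset.sum_congr rfl fun x _ => Finset.sum_congr rfl fun S _ => ?_
    rw [hφe, mul_assoc]
    congr 1
    simp only [b0]
    rw [hψ₀ (fun _ _ => false) x S]
    by_cases h : ∀ i, ψ i (x, S) = true
    · simp [h, bval]
    · have : ∏ i, bval (ψ i (x, S)) = 0 := by
        push Not at h
        obtain ⟨i, hi⟩ := h
        exact Finset.prod_eq_zero (Finset.mem_univ i) (by simp [bval, hi])
      rw [this]
      simp [h, bval]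
  rw [hsum]
  have hJ := jensen_sum' D K
  rw [← hnX] at hJ
  have hG : ∀ x, D x ^ (2 ^ K) * N ^ (2 * K) ≤ N ^ (K * 2 ^ K) *
      ∑ P : Fin K → (Fin m → Fin ℓ) × (Fin m → Fin ℓ),
        ∏ u, (ν (mask x (pick P u)) * b0 (pick P u)) := by
    intro x
    have := gcs K (fun S => ν (mask x S) * b0 S) (fun i S => bval (ψ i (x, S)))
      (fun i S => hbv _) (fun i S S' h => by rw [hψ i x S S' h])
    rw [hcard] at this
    exact this
  set M : ℝ := (2:ℝ) ^ (2 ^ K) with hM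
  have hM1 : 1 ≤ M := one_le_pow₀ (by norm_num)
  have hB : ∑ x, ∑ P : Fin K → (Fin m → Fin ℓ) × (Fin m → Fin ℓ),
        ∏ u, (ν (mask x (pick P u)) * b0 (pick P u)) ≤
      ((2:ℝ)⁻¹ ^ m) ^ (2 ^ K) * nX * (N ^ (2 * K) * (2:ℝ)⁻¹ ^ d) := by
    rw [Finset.sum_comm]
    calc _ ≤ ∑ P : Fin K → (Fin m → Fin ℓ) × (Fin m → Fin ℓ),
          ((2:ℝ)⁻¹ ^ m) ^ (2 ^ K) * nX * (M ^ (2 * (badSet P).card) / M ^ d) := by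
          refine Finset.sum_le_sum fun P _ => ?_
          refine le_trans ?_ (box_bound ν hν ho P)
          simp_rw [Finset.prod_mul_distrib]
          rw [← Finset.sum_mul]
          refine (le_abs_self _).trans ?_
          rw [abs_mul]
          refine mul_le_of_le_one_right (abs_nonneg _) ?_
          rw [Finset.abs_prod]
          exact Finset.prod_le_one (fun _ _ => abs_nonneg _) (fun _ _ => hbv _)
      _ = ((2:ℝ)⁻¹ ^ m) ^ (2 ^ K) * nX * ((∑ P : Fin K → (Fin m → Fin ℓ) × (Fin m → Fin ℓ),
            (M ^ 2) ^ (badSet P).card) / M ^ d) := by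
          rw [← Finset.mul_sum, ← Finset.sum_div]
          simp_rw [pow_mul]
      _ ≤ ((2:ℝ)⁻¹ ^ m) ^ (2 ^ K) * nX * (((((ℓ:ℝ) ^ 2) ^ K) ^ m *
            Real.exp (M ^ 2 * K / ℓ * m)) / M ^ d) := by
          gcongr
          exact sum_bad hl (M ^ 2) (one_le_pow₀ hM1)
      _ = ((2:ℝ)⁻¹ ^ m) ^ (2 ^ K) * nX * (N ^ (2 * K) *
            (Real.exp (M ^ 2 * K / ℓ * m) / M ^ d)) := by
          have : (((ℓ:ℝ) ^ 2) ^ K) ^ m = N ^ (2 * K) := by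
            rw [hN, ← pow_mul, ← pow_mul, ← pow_mul]; congr 1; ring
          rw [this]; ring
      _ ≤ _ := by
          gcongr
          exact exp_bound hK hd hl hℓ
  have hfin : (∑ x, D x) ^ (2 ^ K) ≤ (nX * N ^ K * (2:ℝ)⁻¹ ^ m) ^ (2 ^ K) * (2:ℝ)⁻¹ ^ d := by
    have hpos : 0 < nX * N ^ (2 * K) := by positivity
    refine le_of_mul_le_mul_right ?_ hpos
    calc (∑ x, D x) ^ (2 ^ K) * (nX * N ^ (2 * K))
        = ((∑ x, D x) ^ (2 ^ K) * nX) * N ^ (2 * K) := by ring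
      _ ≤ (nX ^ (2 ^ K) * ∑ x, D x ^ (2 ^ K)) * N ^ (2 * K) := by gcongr
      _ = nX ^ (2 ^ K) * ∑ x, D x ^ (2 ^ K) * N ^ (2 * K) := by rw [mul_assoc, Finset.sum_mul]
      _ ≤ nX ^ (2 ^ K) * ∑ x, N ^ (K * 2 ^ K) *
          ∑ P : Fin K → (Fin m → Fin ℓ) × (Fin m → Fin ℓ),
          ∏ u, (ν (mask x (pick P u)) * b0 (pick P u)) :=
          mul_le_mul_of_nonneg_left (Finset.sum_le_sum fun x _ => hG x) (by positivity)
      _ = nX ^ (2 ^ K) * (N ^ (K * 2 ^ K) * ∑ x,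
          ∑ P : Fin K → (Fin m → Fin ℓ) × (Fin m → Fin ℓ),
          ∏ u, (ν (mask x (pick P u)) * b0 (pick P u))) := by rw [← Finset.mul_sum]
      _ ≤ nX ^ (2 ^ K) * (N ^ (K * 2 ^ K) *
          (((2:ℝ)⁻¹ ^ m) ^ (2 ^ K) * nX * (N ^ (2 * K) * (2:ℝ)⁻¹ ^ d))) := by gcongr
      _ = _ := by
          rw [mul_pow, mul_pow, ← pow_mul N K]; ring
  have he : Even (2 ^ K) := (Nat.even_pow.2 ⟨even_two, by omega⟩)
  rw [← he.pow_abs] at hfin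
  have hr : ((2:ℝ) ^ (-(d:ℝ) / 2 ^ K)) ^ (2 ^ K) = (2:ℝ)⁻¹ ^ d := by
    rw [← Real.rpow_natCast, ← Real.rpow_mul (by norm_num)]
    push_cast
    rw [div_mul_cancel₀ _ (by positivity), Real.rpow_neg (by norm_num), Real.rpow_natCast, inv_pow]
  rw [← hr, ← mul_pow] at hfin
  exact le_of_pow_le_pow_left₀ (by positivity) (by positivity) hfin

lemma main_K (K ℓ m d : ℕ) (hK : 1 ≤ K) (hm : 1 ≤ m)
    (δ : ℝ) (hδ0 : 0 ≤ δ) (hδ1 : δ < 1)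
    (f : (Fin m → Bool) → ℝ) (hf : ∀ z, f z = 1 ∨ f z = -1)
    (hdeg : approxDeg m δ f = d) (hd : 2 < d)
    (hℓ : (2 : ℝ) ^ (2 ^ (K + 1)) * (((K + 1 : ℕ) : ℝ) - 1) * Real.exp 1 * m / d ≤ (ℓ : ℝ) - 1)
    (n : ℕ) (hn : n = ℓ ^ (K) * m) :
    ∃ (g : (Fin m → Bool) → ℝ)
      (lam : (Fin m → (Fin (K) → Fin ℓ) → Bool) × (Fin (K) → Fin m → Fin ℓ) → ℝ),
      (∀ z, g z = 1 ∨ g z = -1) ∧ IsProbDist lam ∧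
      δ < (∑ p, lam p * Ffun f p * Ffun g p) ∧
      disc lam (Ffun g) ≤ (2 : ℝ) ^ (-(d : ℝ) / 2 ^ (K)) := by
  obtain ⟨ν, hν, ho, hcorr⟩ := duality (by omega) δ hδ0 f hdeg
  have hA : (2:ℝ) ^ (2 ^ (K + 1)) = ((2:ℝ) ^ (2 ^ K)) ^ 2 := by
    rw [← pow_mul]; congr 1
  have hKc : (((K + 1 : ℕ) : ℝ) - 1) = K := by push_cast; ring
  rw [hA, hKc] at hℓ
  have hl : 0 < ℓ := by
    have h0 : (0:ℝ) ≤ ((2:ℝ) ^ (2 ^ K)) ^ 2 * K * Real.exp 1 * m / d := by positivity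
    have : (0:ℝ) < ℓ := by linarith
    exact_mod_cast this
  have hl' : (0:ℝ) < ℓ := by exact_mod_cast hl
  have hℓ' : ((2:ℝ) ^ (2 ^ K)) ^ 2 * K * Real.exp 1 * m / d ≤ (ℓ : ℝ) := by linarith
  let g : (Fin m → Bool) → ℝ := fun z => if 0 ≤ ν z then 1 else -1
  have hg : ∀ z, g z = 1 ∨ g z = -1 := by
    intro z; simp only [g]; split_ifs <;> simp
  have hμg : ∀ z, |ν z| * g z = ν z := by
    intro z
    simp only [g]
    split_ifs with h
    · rw [abs_of_nonneg h, mul_one]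
    · rw [abs_of_neg (not_le.1 h)]; ring
  let Z : ℝ := ((2:ℝ) ^ (ℓ ^ K - 1)) ^ m * ((ℓ:ℝ) ^ m) ^ K
  have hZ : 0 < Z := by positivity
  have hnX : (Fintype.card (Fin m → (Fin K → Fin ℓ) → Bool) : ℝ) * ((ℓ:ℝ) ^ m) ^ K * (2:ℝ)⁻¹ ^ m
      = Z := by
    have h1 : (Fintype.card (Fin m → (Fin K → Fin ℓ) → Bool) : ℝ) = ((2:ℝ) ^ (ℓ ^ K)) ^ m := by
      simp
    have h2 : (2:ℝ) ^ (ℓ ^ K) = 2 ^ (ℓ ^ K - 1) * 2 := by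
      rw [← pow_succ, Nat.sub_add_cancel (Nat.one_le_pow _ _ hl)]
    have h3 : (2:ℝ) ^ m * (2:ℝ)⁻¹ ^ m = 1 := by rw [← mul_pow]; norm_num
    rw [h1, h2, mul_pow]
    calc _ = Z * ((2:ℝ) ^ m * (2:ℝ)⁻¹ ^ m) := by simp only [Z]; ring
      _ = Z := by rw [h3, mul_one]
  have hsum : ∀ F : (Fin m → Bool) → ℝ,
      ∑ p : (Fin m → (Fin K → Fin ℓ) → Bool) × (Fin K → Fin m → Fin ℓ), F (mask p.1 p.2)
        = Z * ∑ z, F z := by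
    intro F
    rw [Fintype.sum_prod_type_right]
    simp_rw [sum_mask]
    simp [Z]
    ring
  refine ⟨g, fun p => |ν (mask p.1 p.2)| / Z, hg, ⟨fun p => by positivity, ?_⟩, ?_, ?_⟩
  · rw [← Finset.sum_div, hsum (fun z => |ν z|), hν, mul_one, div_self hZ.ne']
  · have : ∑ p : (Fin m → (Fin K → Fin ℓ) → Bool) × (Fin K → Fin m → Fin ℓ),
        |ν (mask p.1 p.2)| / Z * Ffun f p * Ffun g p = ∑ z, ν z * f z := by
      have h1 : ∀ p : (Fin m → (Fin K → Fin ℓ) → Bool) × (Fin K → Fin m → Fin ℓ),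
          |ν (mask p.1 p.2)| / Z * Ffun f p * Ffun g p
            = (ν (mask p.1 p.2) * f (mask p.1 p.2)) / Z := by
        intro p
        rw [← hμg (mask p.1 p.2)]
        simp only [Ffun, abs_mul, abs_abs]
        have : |g (mask p.1 p.2)| = 1 := by
          rcases hg (mask p.1 p.2) with h | h <;> simp [h]
        rw [this]; ring
      simp_rw [h1]
      rw [← Finset.sum_div, hsum (fun z => ν z * f z), mul_div_cancel_left₀ _ hZ.ne']
    exact hcorr.trans_eq this.symm
  · unfold disc
    apply Real.sSup_le
    · rintro t ⟨φ, hφ, rfl⟩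
      have h1 := disc_core hK (by omega) hl hℓ' ν hν ho φ hφ
      rw [hnX] at h1
      unfold discPhi
      have h2 : ∑ p, |ν (mask p.1 p.2)| / Z * Ffun g p * bval (φ p)
          = (∑ p, ν (mask p.1 p.2) * bval (φ p)) / Z := by
        rw [Finset.sum_div]
        refine Finset.sum_congr rfl fun p _ => ?_
        have := hμg (mask p.1 p.2)
        simp only [Ffun]
        calc _ = (|ν (mask p.1 p.2)| * g (mask p.1 p.2)) * bval (φ p) / Z := by ring
          _ = _ := by rw [this]
      rw [h2, abs_div, abs_of_pos hZ, div_le_iff₀ hZ, mul_comm]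
      exact h1
    · positivity

/-- Discrepancy form of the Main Theorem: if `deg_δ(f) = d > 2` and
`ℓ - 1 ≥ 2^{2^k}(k-1)e·m/d`, then there are `g : {0,1}^m → {-1,1}` and a probability
distribution `λ` on `{0,1}^n × ([ℓ]^m)^{k-1}` with `Corr_λ(F^f_k, F^g_k) > δ` and
`disc_{k,λ}(F^g_k) ≤ 2^{-d/2^{k-1}}`. -/
theorem statement11 (k ℓ m d : ℕ) (hk : 2 ≤ k) (hm : 1 ≤ m)
    (δ : ℝ) (hδ0 : 0 ≤ δ) (hδ1 : δ < 1)
    (f : (Fin m → Bool) → ℝ) (hf : ∀ z, f z = 1 ∨ f z = -1)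
    (hdeg : approxDeg m δ f = d) (hd : 2 < d)
    (hℓ : (2 : ℝ) ^ (2 ^ k) * (k - 1) * Real.exp 1 * m / d ≤ (ℓ : ℝ) - 1)
    (n : ℕ) (hn : n = ℓ ^ (k - 1) * m) :
    ∃ (g : (Fin m → Bool) → ℝ)
      (lam : (Fin m → (Fin (k - 1) → Fin ℓ) → Bool) × (Fin (k - 1) → Fin m → Fin ℓ) → ℝ),
      (∀ z, g z = 1 ∨ g z = -1) ∧ IsProbDist lam ∧
      δ < (∑ p, lam p * Ffun f p * Ffun g p) ∧
      disc lam (Ffun g) ≤ (2 : ℝ) ^ (-(d : ℝ) / 2 ^ (k - 1)) := by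
  obtain ⟨K, rfl⟩ : ∃ K, k = K + 1 := ⟨k - 1, by omega⟩
  exact main_K K ℓ m d (by omega) hm δ hδ0 hδ1 f hf hdeg hd hℓ n hn
end
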